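/- arXiv:2605.19096 — 3 statements merged into one kernel-verified Lean document; each statement's English description precedes it below -/
import Mathlib

section
/- Random orthonormal sketching identity: let Ω ∈ K^{n×ℓ} be a random orthonormal embedding partitioned as Ω = [Ω₁; Ω₂], where Ω₁ consists of the first r rows and Ω₂ of the last n − r rows, with r + α_K < ℓ. Then for any invertible matrix R ∈ K^{ℓ×ℓ} and any matrix B ∈ K^{(n−r)×p}, E‖(R*Ω₁*)⁺ R* Ω₂* B‖_F² ≥ ((n − ℓ)/(n − r)) · (r/(ℓ − r − α_K)) · ‖B‖_F², and this lower bound holds with equality when R = I. -/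
open MeasureTheory ProbabilityTheory Matrix Filter
open scoped ENNReal Topology ComplexOrder

noncomputable section

open Classical in
/-- `α_K`: 1 if `K = ℝ`, 0 if `K = ℂ`. -/
def alphaK (K : Type*) [RCLike K] : ℝ := if (RCLike.I : K) = 0 then 1 else 0

/-- Squared Frobenius norm of a matrix. -/
def frobSq {K : Type*} [RCLike K] {m n : Type*} [Fintype m] [Fintype n]
    (A : Matrix m n K) : ℝ := ∑ i, ∑ j, ‖A i j‖ ^ 2

/-- The four Penrose conditions characterizing the Moore–Penrose pseudoinverse. -/
def IsMoorePenrose {K : Type*} [RCLike K] {m n : Type*} [Fintype m] [Fintype n]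
    (A : Matrix m n K) (X : Matrix n m K) : Prop :=
  A * X * A = A ∧ X * A * X = X ∧ (A * X)ᴴ = A * X ∧ (X * A)ᴴ = X * A

instance matrixMeasurableSpace {m n α : Type*} [MeasurableSpace α] :
    MeasurableSpace (Matrix m n α) :=
  inferInstanceAs (MeasurableSpace (m → n → α))

/-- `M` is rotation-invariant: `U * M` has the same distribution as `M` for every unitary `U`. -/
def RotationInvariant {K : Type*} [RCLike K] [MeasurableSpace K]
    {Y : Type*} [MeasurableSpace Y] (μ : Measure Y) {n ℓ : ℕ}
    (M : Y → Matrix (Fin n) (Fin ℓ) K) : Prop :=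
  ∀ U : Matrix (Fin n) (Fin n) K, U ∈ Matrix.unitaryGroup (Fin n) K →
    Measure.map (fun ω => U * M ω) μ = Measure.map M μ

/-- `M` is a random orthonormal embedding: rotation-invariant, with orthonormal
columns almost surely. -/
def IsRandomOrthonormal {K : Type*} [RCLike K] [MeasurableSpace K]
    {Y : Type*} [MeasurableSpace Y] (μ : Measure Y) {n ℓ : ℕ}
    (M : Y → Matrix (Fin n) (Fin ℓ) K) : Prop :=
  Measurable M ∧ RotationInvariant μ M ∧ ∀ᵐ ω ∂μ, (M ω)ᴴ * M ω = 1


/-! ### Part 1: inverse moment of a standard Gaussian -/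

lemma aux_gauss_one (t : ℝ) (ht : 0 ≤ t) :
    ∫⁻ x, ENNReal.ofReal (Real.exp (-t * x ^ 2)) ∂(gaussianReal 0 1)
      = ENNReal.ofReal ((1 + 2 * t) ^ (-(1 / 2) : ℝ)) := by
  rw [gaussianReal_of_var_ne_zero _ one_ne_zero,
    lintegral_withDensity_eq_lintegral_mul _ (measurable_gaussianPDF 0 1) (by fun_prop)]
  have h1 : ∀ x : ℝ, (gaussianPDF 0 1 * fun x => ENNReal.ofReal (Real.exp (-t * x ^ 2))) x
      = ENNReal.ofReal ((√(2 * Real.pi))⁻¹ * Real.exp (-(t + 1 / 2) * x ^ 2)) := by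
    intro x
    simp only [Pi.mul_apply, gaussianPDF, gaussianPDFReal]
    rw [← ENNReal.ofReal_mul (by positivity), mul_assoc, ← Real.exp_add]
    simp
    ring_nf
  simp_rw [h1]
  have hb : 0 < t + 1 / 2 := by linarith
  rw [← ofReal_integral_eq_lintegral_ofReal ((integrable_exp_neg_mul_sq hb).const_mul _)
    (Eventually.of_forall fun x => by positivity), integral_const_mul, integral_gaussian]
  congr 1
  rw [Real.rpow_neg (by linarith), ← Real.sqrt_eq_rpow, ← Real.sqrt_inv, ← Real.sqrt_inv,
    ← Real.sqrt_mul (by positivity)]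
  congr 1
  have := Real.pi_pos
  field_simp
  try ring

lemma aux_inv_eq (q : ℝ) (hq : 0 ≤ q) :
    (ENNReal.ofReal q)⁻¹ = ∫⁻ t in Set.Ioi (0 : ℝ), ENNReal.ofReal (Real.exp (-t * q)) := by
  rcases hq.eq_or_lt with h | h
  · subst h; simp
  · rw [← ofReal_integral_eq_lintegral_ofReal]
    · have := integral_exp_mul_Ioi (a := -q) (by linarith) 0
      simp only [neg_mul] at this ⊢
      simp_rw [mul_comm _ q, this]
      rw [ENNReal.ofReal_inv_of_pos h |>.symm]
      congr 1
      simp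
    · have := integrableOn_exp_mul_Ioi (a := -q) (by linarith) 0
      simpa [mul_comm, IntegrableOn] using this
    · exact Eventually.of_forall fun x => by positivity

lemma aux_int_rpow (m : ℝ) (hm : 2 < m) :
    ∫⁻ t in Set.Ioi (0 : ℝ), ENNReal.ofReal ((1 + 2 * t) ^ (-(m / 2)))
      = ENNReal.ofReal (1 / (m - 2)) := by
  have hd : ∀ x ∈ Set.Ici (0:ℝ), HasDerivAt (fun t : ℝ => -(1 / (m - 2)) * (1 + 2 * t) ^ (1 - m / 2))
      ((1 + 2 * x) ^ (-(m / 2))) x := by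
    intro x hx
    have hx : 0 ≤ x := hx
    have h1 : HasDerivAt (fun t : ℝ => 1 + 2 * t) 2 x := by
      simpa using ((hasDerivAt_id x).const_mul 2).const_add 1
    have := (h1.rpow_const (p := 1 - m / 2) (Or.inl (by positivity))).const_mul (-(1 / (m - 2)))
    refine this.congr_deriv ?_
    have : m - 2 ≠ 0 := by linarith
    rw [show 1 - m / 2 - 1 = -(m / 2) by ring]
    field_simp
    ring
  have ht : Tendsto (fun t : ℝ => -(1 / (m - 2)) * (1 + 2 * t) ^ (1 - m / 2)) atTop (𝓝 0) := by
    have h2 : Tendsto (fun t : ℝ => 1 + 2 * t) atTop atTop :=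
      tendsto_atTop_add_const_left _ _ (tendsto_id.const_mul_atTop (by norm_num))
    have := ((tendsto_rpow_neg_atTop (y := m / 2 - 1) (by linarith)).comp h2).const_mul
      (-(1 / (m - 2)))
    simpa [Function.comp_def] using this
  have hpos : ∀ x ∈ Set.Ioi (0:ℝ), 0 ≤ (1 + 2 * x) ^ (-(m / 2)) := by
    intro x hx
    have hx : 0 < x := hx
    positivity
  have hint := integrableOn_Ioi_deriv_of_nonneg' hd hpos ht
  rw [← ofReal_integral_eq_lintegral_ofReal hint, integral_Ioi_of_hasDerivAt_of_nonneg' hd hpos ht]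
  · congr 1; simp
  · exact (ae_restrict_iff' measurableSet_Ioi).2 (Eventually.of_forall hpos)

lemma aux_gauss_inv {E : Type*} [NormedAddCommGroup E] [InnerProductSpace ℝ E]
    [FiniteDimensional ℝ E] [MeasurableSpace E] [BorelSpace E] (h : 2 < Module.finrank ℝ E) :
    ∫⁻ x, (ENNReal.ofReal (‖x‖ ^ 2))⁻¹ ∂(stdGaussian E)
      = ENNReal.ofReal (1 / ((Module.finrank ℝ E : ℝ) - 2)) := by
  rw [← aux_int_rpow _ (by exact_mod_cast h)]
  simp_rw [aux_inv_eq _ (sq_nonneg _)]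
  rw [lintegral_lintegral_swap (by fun_prop)]
  refine setLIntegral_congr_fun measurableSet_Ioi fun t ht => ?_
  have ht : 0 < t := ht
  rw [stdGaussian, lintegral_map (by fun_prop) (by fun_prop)]
  have h1 : ∀ x : Fin (Module.finrank ℝ E) → ℝ,
      ENNReal.ofReal (Real.exp (-t * ‖∑ i, x i • stdOrthonormalBasis ℝ E i‖ ^ 2))
      = ∏ i, ENNReal.ofReal (Real.exp (-t * (x i) ^ 2)) := by
    intro x
    rw [← ENNReal.ofReal_prod_of_nonneg (fun _ _ => by positivity), ← Real.exp_sum,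
      ← Finset.mul_sum]
    congr 3
    rw [← (stdOrthonormalBasis ℝ E).sum_sq_norm_inner_right]
    refine Finset.sum_congr rfl fun i _ => ?_
    rw [(stdOrthonormalBasis ℝ E).orthonormal.inner_right_fintype]
    simp
  simp_rw [h1]
  rw [lintegral_prod_eq_prod_lintegral_of_indepFun Finset.univ
    (fun i (x : Fin (Module.finrank ℝ E) → ℝ) => ENNReal.ofReal (Real.exp (-t * (x i) ^ 2)))
    (iIndepFun_pi (X := fun _ (y : ℝ) => ENNReal.ofReal (Real.exp (-t * y ^ 2)))
      (fun _ => by fun_prop)) (fun _ => by fun_prop)]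
  have h2 : ∀ i : Fin (Module.finrank ℝ E), ∫⁻ x : Fin (Module.finrank ℝ E) → ℝ,
      ENNReal.ofReal (Real.exp (-t * (x i) ^ 2)) ∂(Measure.pi fun _ => gaussianReal 0 1)
      = ENNReal.ofReal ((1 + 2 * t) ^ (-(1 / 2) : ℝ)) := by
    intro i
    rw [← aux_gauss_one t ht.le]
    exact (measurePreserving_eval (fun _ : Fin (Module.finrank ℝ E) => gaussianReal 0 1)
      i).lintegral_comp (f := fun y => ENNReal.ofReal (Real.exp (-t * y ^ 2))) (by fun_prop)
  simp_rw [h2]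
  rw [Finset.prod_const, ← ENNReal.ofReal_pow (by positivity), ← Real.rpow_natCast,
    ← Real.rpow_mul (by positivity)]
  simp
  congr 2
  ring

/-! ### Part 2: Gaussian measure on a `K`-inner product space -/

/-- real dimension of `K`. -/
abbrev dK (K : Type*) [RCLike K] : ℕ := Module.finrank ℝ K

lemma dK_pos (K : Type*) [RCLike K] : 0 < dK K := Module.finrank_pos

lemma dK_alpha (K : Type*) [RCLike K] : (dK K : ℝ) * (1 + alphaK K) = 2 := by
  unfold alphaK
  have h1 : Module.finrank ℝ K = if (RCLike.I : K) = 0 then 1 else 2 := by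
    split_ifs with h
    · have := (RCLike.realLinearIsometryEquiv h).toLinearEquiv.finrank_eq
      simpa using this
    · have him : RCLike.im (RCLike.I : K) = 1 := by
        have h2 := RCLike.mul_im_I_ax (RCLike.I : K)
        by_contra h3
        have h4 : RCLike.im (RCLike.I : K) = 0 := by
          by_contra h5
          exact h3 (mul_left_cancel₀ h5 (by rw [mul_one]; exact h2))
        apply h
        rw [← RCLike.re_add_im (RCLike.I : K), h4]
        simp
      have := (RCLike.complexLinearIsometryEquiv him).toLinearEquiv.finrank_eq
      rw [this, Complex.finrank_real_complex]
  unfold dK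
  rw [h1]
  split_ifs <;> norm_num

/-- standard Gaussian on a finite-dimensional `K`-inner product space. -/
def gK (K : Type*) [RCLike K] (E : Type*) [NormedAddCommGroup E] [InnerProductSpace K E]
    [FiniteDimensional K E] [MeasurableSpace E] : Measure E :=
  letI : InnerProductSpace ℝ E := InnerProductSpace.rclikeToReal K E
  haveI : IsScalarTower ℝ K E := inferInstance
  haveI : FiniteDimensional ℝ E := FiniteDimensional.trans ℝ K E
  stdGaussian E

section gK
variable (K : Type*) [RCLike K] (E : Type*) [NormedAddCommGroup E] [InnerProductSpace K E]
    [FiniteDimensional K E] [MeasurableSpace E] [BorelSpace E]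

instance gK_prob : IsProbabilityMeasure (gK K E) := by
  unfold gK
  infer_instance

lemma gK_inv (h : 2 < dK K * Module.finrank K E) :
    ∫⁻ x, (ENNReal.ofReal (‖x‖ ^ 2))⁻¹ ∂(gK K E)
      = ENNReal.ofReal (1 / ((dK K : ℝ) * (Module.finrank K E : ℝ) - 2)) := by
  let : InnerProductSpace ℝ E := InnerProductSpace.rclikeToReal K E
  have : FiniteDimensional ℝ E := FiniteDimensional.trans ℝ K E
  have h1 : Module.finrank ℝ E = dK K * Module.finrank K E := (Module.finrank_mul_finrank ℝ K E).symm
  rw [gK, aux_gauss_inv (by rw [h1]; exact h), h1]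
  push_cast
  rfl

variable {E}
lemma gK_map {F : Type*} [NormedAddCommGroup F] [InnerProductSpace K F]
    [FiniteDimensional K F] [MeasurableSpace F] [BorelSpace F] (L : E →ₗ[K] F) (A : F → E)
    (hLA : ∀ x y, inner K (L x) y = inner K x (A y)) (hA : ∀ y, ‖A y‖ = ‖y‖) :
    Measure.map L (gK K E) = gK K F := by
  let : InnerProductSpace ℝ E := InnerProductSpace.rclikeToReal K E
  have : FiniteDimensional ℝ E := FiniteDimensional.trans ℝ K E
  let : InnerProductSpace ℝ F := InnerProductSpace.rclikeToReal K F
  have : FiniteDimensional ℝ F := FiniteDimensional.trans ℝ K F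
  have hL : Continuous L := L.continuous_of_finiteDimensional
  have : IsFiniteMeasure (Measure.map L (stdGaussian E)) := by
    infer_instance
  unfold gK
  apply Measure.ext_of_charFun
  ext t
  rw [charFun_stdGaussian, charFun_apply, integral_map hL.measurable.aemeasurable
    (Measurable.aestronglyMeasurable (by fun_prop)), ← hA t, ← charFun_stdGaussian, charFun_apply]
  congr 1
  ext x
  have : inner ℝ (L x) t = inner ℝ x (A t) := by
    change RCLike.re (inner K (L x) t) = RCLike.re (inner K x (A t))
    rw [hLA]
  rw [this]

end gK

/-! ### Part 3: geometry for a fixed orthonormal matrix -/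

section geom
variable {K : Type*} [RCLike K] {n ℓ : ℕ}

/-- The map `x ↦ Ω* x`. -/
def TT (Ω : Matrix (Fin n) (Fin ℓ) K) : EuclideanSpace K (Fin n) →ₗ[K] EuclideanSpace K (Fin ℓ) :=
  Matrix.toEuclideanLin Ωᴴ

/-- Vectors supported in `J`. -/
def UU (K : Type*) [RCLike K] {n : ℕ} (J : Finset (Fin n)) :
    Submodule K (EuclideanSpace K (Fin n)) where
  carrier := {x | ∀ j, j ∉ J → x j = 0}
  zero_mem' := by intro j _; simp
  add_mem' := by
    intro a b ha hb j hj
    simp [ha j hj, hb j hj]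
  smul_mem' := by
    intro c a ha j hj
    simp [ha j hj]

lemma mem_UU (J : Finset (Fin n)) (x : EuclideanSpace K (Fin n)) :
    x ∈ UU K J ↔ ∀ j, j ∉ J → x j = 0 := Iff.rfl

lemma finrank_UU (J : Finset (Fin n)) : Module.finrank K (UU K J) = J.card := by
  let e : UU K J ≃ₗ[K] (J → K) :=
    { toFun := fun x j => x.1 j
      map_add' := by intro x y; ext j; simp
      map_smul' := by intro x y; ext j; simp
      invFun := fun c => ⟨WithLp.toLp 2 (fun j => if h : j ∈ J then c ⟨j, h⟩ else 0), by
        intro j hj; simp [hj]⟩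
      left_inv := by
        intro x
        ext j
        by_cases h : j ∈ J
        · simp [h]
        · simp [h, x.2 j h]
      right_inv := by
        intro c; ext j; simp }
  rw [e.finrank_eq]
  simp

/-- squared distance functional. -/
def Dq (Ω : Matrix (Fin n) (Fin ℓ) K) (J : Finset (Fin n)) (v : EuclideanSpace K (Fin n)) : ℝ≥0∞ :=
  ⨅ u : UU K J, ENNReal.ofReal (‖TT Ω (v + u)‖ ^ 2)

lemma TT_adj (Ω : Matrix (Fin n) (Fin ℓ) K) (x : EuclideanSpace K (Fin n))
    (y : EuclideanSpace K (Fin ℓ)) :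
    inner K (TT Ω x) y = inner K x (Matrix.toEuclideanLin Ω y) := by
  unfold TT
  rw [Matrix.toEuclideanLin_conjTranspose_eq_adjoint, LinearMap.adjoint_inner_left]

lemma TT_TT' (Ω : Matrix (Fin n) (Fin ℓ) K) (h : Ωᴴ * Ω = 1) (y : EuclideanSpace K (Fin ℓ)) :
    TT Ω (Matrix.toEuclideanLin Ω y) = y := by
  unfold TT
  ext i
  simp [Matrix.toLpLin_apply, h]

lemma Dq_smul (Ω : Matrix (Fin n) (Fin ℓ) K) (J : Finset (Fin n)) (v : EuclideanSpace K (Fin n))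
    (c : K) (hc : c ≠ 0) : Dq Ω J (c • v) = ENNReal.ofReal (‖c‖ ^ 2) * Dq Ω J v := by
  unfold Dq
  rw [ENNReal.mul_iInf (by simp)]
  refine le_antisymm ?_ ?_
  · refine le_iInf fun u => ?_
    refine (iInf_le _ (c • u)).trans (le_of_eq ?_)
    rw [← ENNReal.ofReal_mul (by positivity), Submodule.coe_smul, ← smul_add, map_smul, norm_smul,
      mul_pow]
  · refine le_iInf fun u => ?_
    refine (iInf_le _ (c⁻¹ • u)).trans (le_of_eq ?_)
    rw [← ENNReal.ofReal_mul (by positivity), ← mul_pow, ← norm_smul, ← map_smul, smul_add,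
      Submodule.coe_smul, smul_inv_smul₀ hc]

lemma Dq_gauss [MeasurableSpace K] [BorelSpace K]
    (Ω : Matrix (Fin n) (Fin ℓ) K) (h : Ωᴴ * Ω = 1) (J : Finset (Fin n))
    (hd : 2 < dK K * Module.finrank K ↥((UU K J).map (TT Ω))ᗮ) :
    ∫⁻ g, (Dq Ω J (g : EuclideanSpace K (Fin n)))⁻¹ ∂(gK K (UU K Jᶜ))
      = ENNReal.ofReal (1 / ((dK K : ℝ) *
        (Module.finrank K ↥((UU K J).map (TT Ω))ᗮ : ℝ) - 2)) := by
  set S := (UU K J).map (TT Ω) with hS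
  rw [← gK_inv K _ hd]
  let L : UU K Jᶜ →ₗ[K] Sᗮ :=
    (Sᗮ.orthogonalProjectionOnto : EuclideanSpace K (Fin ℓ) →ₗ[K] Sᗮ) ∘ₗ (TT Ω) ∘ₗ (UU K Jᶜ).subtype
  have hmem : ∀ y : Sᗮ, Matrix.toEuclideanLin Ω y ∈ UU K Jᶜ := by
    intro y j hj
    have hj : j ∈ J := by simpa using hj
    have h1 : EuclideanSpace.single j (1 : K) ∈ UU K J := by
      intro k hk
      have : k ≠ j := fun h => hk (h ▸ hj)
      simp [this]
    have h2 := (Submodule.mem_orthogonal _ _).1 y.2 _ (Submodule.mem_map_of_mem h1)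
    rw [TT_adj] at h2
    simpa [EuclideanSpace.inner_single_left] using h2
  let A : Sᗮ → UU K Jᶜ := fun y => ⟨Matrix.toEuclideanLin Ω y, hmem y⟩
  have hmap := gK_map K L A (by
      intro x y
      have h1 : inner K x (A y) = inner K (x : EuclideanSpace K (Fin n))
        (Matrix.toEuclideanLin Ω (y : EuclideanSpace K (Fin ℓ))) := rfl
      have h2 : L x = Sᗮ.orthogonalProjectionOnto (TT Ω x) := rfl
      rw [h1, ← TT_adj, h2, Submodule.inner_orthogonalProjectionOnto_eq_of_mem_right]) (by
      intro y
      simp only [Submodule.coe_norm, A]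
      have : inner K (Matrix.toEuclideanLin Ω (y : EuclideanSpace K (Fin ℓ))) (Matrix.toEuclideanLin Ω y)
          = inner K (y : EuclideanSpace K (Fin ℓ)) y := by
        rw [← TT_adj, TT_TT' Ω h]
      rw [@norm_eq_sqrt_re_inner K, @norm_eq_sqrt_re_inner K _ _ _ _ (y : EuclideanSpace K (Fin ℓ)),
        this])
  rw [← hmap, lintegral_map (by fun_prop) (L.continuous_of_finiteDimensional.measurable)]
  refine lintegral_congr fun g => ?_
  congr 1
  unfold Dq
  refine le_antisymm ?_ ?_
  · obtain ⟨u, hu, hu'⟩ : S.starProjection (TT Ω g) ∈ S := Submodule.starProjection_apply_mem _ _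
    refine (iInf_le _ (-⟨u, hu⟩)).trans (le_of_eq ?_)
    congr 2
    rw [Submodule.coe_neg, map_add, map_neg, hu', Submodule.coe_norm]
    congr 1
    simp only [L, LinearMap.comp_apply, ContinuousLinearMap.coe_coe]
    rw [← Submodule.starProjection_apply, Submodule.starProjection_orthogonal']
    simp [sub_eq_add_neg]
  · refine le_iInf fun u => ?_
    apply ENNReal.ofReal_le_ofReal
    gcongr
    have h1 : L g = Sᗮ.orthogonalProjectionOnto (TT Ω (g + u)) := by
      rw [map_add, map_add, Submodule.orthogonalProjectionOnto_orthogonal_apply_eq_zero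
        (Submodule.mem_map_of_mem u.2)]
      simp [L]
    rw [h1]
    exact Submodule.norm_orthogonalProjectionOnto_apply_le _ _

lemma finrank_perp (Ω : Matrix (Fin n) (Fin ℓ) K) (J : Finset (Fin n)) :
    ℓ ≤ Module.finrank K ↥((UU K J).map (TT Ω))ᗮ + J.card ∧
    ((∀ u ∈ UU K J, TT Ω u = 0 → u = 0) →
      ℓ = Module.finrank K ↥((UU K J).map (TT Ω))ᗮ + J.card) := by
  have h1 := Submodule.finrank_add_finrank_orthogonal ((UU K J).map (TT Ω))
  rw [finrank_euclideanSpace_fin] at h1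
  have h2 := Submodule.finrank_map_le (TT Ω) (UU K J)
  rw [finrank_UU] at h2
  refine ⟨by omega, fun h => ?_⟩
  have h3 : Module.finrank K ((UU K J).map (TT Ω)) = Module.finrank K (UU K J) := by
    have hinj : Function.Injective ((TT Ω) ∘ₗ (UU K J).subtype) := by
      rw [injective_iff_map_eq_zero]
      intro a ha
      exact Subtype.ext (h a a.2 ha)
    rw [← LinearMap.finrank_range_of_inj hinj, LinearMap.range_comp, Submodule.range_subtype]
  rw [finrank_UU] at h3
  omega

lemma exists_rot (J : Finset (Fin n)) (i : Fin n) (hi : i ∉ J) (v : EuclideanSpace K (Fin n))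
    (hv : v ∈ UU K Jᶜ) (hv1 : ‖v‖ = 1) :
    ∃ V ∈ Matrix.unitaryGroup (Fin n) K, (∀ u ∈ UU K J, Matrix.toEuclideanLin Vᴴ u = u) ∧
      Matrix.toEuclideanLin Vᴴ (EuclideanSpace.single i 1) = v := by
  classical
  let w : Fin n → EuclideanSpace K (Fin n) :=
    fun j => if j = i then v else EuclideanSpace.single j 1
  have hvJ : ∀ j ∈ J, v j = 0 := fun j hj => hv j (by simpa using hj)
  have hw : Orthonormal K ((insert i (J : Set (Fin n))).domRestrict w) := by
    rw [orthonormal_iff_ite]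
    rintro ⟨a, ha⟩ ⟨b, hb⟩
    simp only [Set.domRestrict_apply, Subtype.mk.injEq, w]
    by_cases hai : a = i
    · by_cases hbi : b = i
      · simp [hai, hbi, hv1, inner_self_eq_norm_sq_to_K]
      · have hbJ : b ∈ J := by simpa [hbi] using hb
        have : ¬ i = b := fun h => hbi h.symm
        simp [hai, hbi, this, EuclideanSpace.inner_single_right, hvJ b hbJ]
    · have haJ : a ∈ J := by simpa [hai] using ha
      by_cases hbi : b = i
      · simp [hai, hbi, EuclideanSpace.inner_single_left, hvJ a haJ]
      · simp [hai, hbi, EuclideanSpace.inner_single_left]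
  obtain ⟨b, hb⟩ := hw.exists_orthonormalBasis_extension_of_card_eq
    (by simp)
  let Q := (EuclideanSpace.basisFun (Fin n) K).toBasis.toMatrix b
  have hQ : Q ∈ Matrix.unitaryGroup (Fin n) K :=
    (EuclideanSpace.basisFun (Fin n) K).toMatrix_orthonormalBasis_mem_unitary b
  have hQs : ∀ j, Matrix.toEuclideanLin Q (EuclideanSpace.single j 1) = b j := by
    intro j
    ext k
    simp [Q, Matrix.toLpLin_apply, Module.Basis.toMatrix_apply]
  refine ⟨Qᴴ, ?_, ?_, ?_⟩
  · exact Unitary.star_mem hQ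
  · intro u hu
    rw [conjTranspose_conjTranspose]
    have hu' : u = ∑ j, u j • EuclideanSpace.single j (1 : K) := by
      ext k
      simp [Pi.single_apply]
    conv_lhs => rw [hu']
    conv_rhs => rw [hu']
    rw [map_sum]
    refine Finset.sum_congr rfl fun j _ => ?_
    rw [map_smul, hQs]
    by_cases hj : j ∈ J
    · rw [hb j (by simp [hj])]
      have : j ≠ i := fun h => hi (h ▸ hj)
      simp [w, this]
    · simp [hu j hj]
  · rw [conjTranspose_conjTranspose, hQs, hb i (by simp)]
    simp [w]

lemma TT_mul (V : Matrix (Fin n) (Fin n) K) (Ω : Matrix (Fin n) (Fin ℓ) K)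
    (x : EuclideanSpace K (Fin n)) : TT (V * Ω) x = TT Ω (Matrix.toEuclideanLin Vᴴ x) := by
  unfold TT
  ext k
  simp [Matrix.toLpLin_apply]

end geom

/-! ### Part 4: averaging -/

section avg
variable {K : Type*} [RCLike K] [MeasurableSpace K] [BorelSpace K] {n ℓ : ℕ}

instance matrix_borel {n ℓ : ℕ} : BorelSpace (Matrix (Fin n) (Fin ℓ) K) :=
  inferInstanceAs (BorelSpace (Fin n → Fin ℓ → K))

instance matrix_sct {n ℓ : ℕ} : SecondCountableTopology (Matrix (Fin n) (Fin ℓ) K) :=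
  inferInstanceAs (SecondCountableTopology (Fin n → Fin ℓ → K))

lemma Dq_meas (J : Finset (Fin n)) :
    Measurable (fun p : Matrix (Fin n) (Fin ℓ) K × EuclideanSpace K (Fin n) => Dq p.1 J p.2) := by
  apply UpperSemicontinuous.measurable
  unfold Dq
  refine upperSemicontinuous_iInf fun u => Continuous.upperSemicontinuous ?_
  refine ENNReal.continuous_ofReal.comp ?_
  refine (continuous_norm.comp ?_).pow 2
  unfold TT
  simp only [Matrix.toLpLin_apply]
  fun_prop

variable {Y : Type*} [MeasurableSpace Y] {μ : Measure Y}
  {M : Y → Matrix (Fin n) (Fin ℓ) K}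

lemma lint_rot (hM : IsRandomOrthonormal μ M) (f : Matrix (Fin n) (Fin ℓ) K → ℝ≥0∞)
    (hf : Measurable f) (V : Matrix (Fin n) (Fin n) K) (hV : V ∈ Matrix.unitaryGroup (Fin n) K) :
    ∫⁻ ω, f (V * M ω) ∂μ = ∫⁻ ω, f (M ω) ∂μ := by
  have hc : Measurable (fun A : Matrix (Fin n) (Fin ℓ) K => V * A) :=
    Continuous.measurable (by fun_prop)
  rw [← lintegral_map hf hM.1, ← hM.2.1 V hV, lintegral_map (g := fun ω => V * M ω) hf (hc.comp hM.1)]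

lemma avg_unit (hM : IsRandomOrthonormal μ M) (J : Finset (Fin n)) (i : Fin n) (hi : i ∉ J)
    (v : EuclideanSpace K (Fin n)) (hv : v ∈ UU K Jᶜ) (hv1 : ‖v‖ = 1) :
    ∫⁻ ω, (Dq (M ω) J v)⁻¹ ∂μ = ∫⁻ ω, (Dq (M ω) J (EuclideanSpace.single i 1))⁻¹ ∂μ := by
  obtain ⟨V, hV, h1, h2⟩ := exists_rot J i hi v hv hv1
  rw [← lint_rot hM (fun A => (Dq A J (EuclideanSpace.single i 1))⁻¹)
    ((Dq_meas J).comp (measurable_id.prodMk measurable_const)).inv V hV]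
  refine lintegral_congr fun ω => ?_
  congr 1
  unfold Dq
  refine iInf_congr fun u => ?_
  rw [TT_mul, map_add (Matrix.toEuclideanLin Vᴴ), h2, h1 u u.2]

lemma avg_vec (hM : IsRandomOrthonormal μ M) (J : Finset (Fin n)) (i : Fin n) (hi : i ∉ J)
    (v : EuclideanSpace K (Fin n)) (hv : v ∈ UU K Jᶜ) (hv0 : v ≠ 0) :
    ∫⁻ ω, (Dq (M ω) J v)⁻¹ ∂μ = (ENNReal.ofReal (‖v‖ ^ 2))⁻¹ *
      ∫⁻ ω, (Dq (M ω) J (EuclideanSpace.single i 1))⁻¹ ∂μ := by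
  have hn : ‖v‖ ≠ 0 := norm_ne_zero_iff.2 hv0
  have hc : ((‖v‖ : ℝ) : K) ≠ 0 := by exact_mod_cast hn
  have h1 : ((‖v‖ : ℝ) : K) • ((((‖v‖ : ℝ) : K)⁻¹) • v) = v := smul_inv_smul₀ hc v
  have h2 : ‖(((‖v‖ : ℝ) : K)⁻¹) • v‖ = 1 := by
    rw [norm_smul, norm_inv, RCLike.norm_ofReal, abs_norm, inv_mul_cancel₀ hn]
  rw [← avg_unit hM J i hi _ (Submodule.smul_mem _ _ hv) h2, ← lintegral_const_mul' _ _ (by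
    simp only [ne_eq, ENNReal.inv_eq_top, ENNReal.ofReal_eq_zero, not_le]; positivity)]
  refine lintegral_congr fun ω => ?_
  conv_lhs => rw [← h1]
  rw [Dq_smul _ _ _ _ hc, ENNReal.mul_inv (Or.inl ?_) (Or.inl ENNReal.ofReal_ne_top)]
  · simp
  · have : 0 < ‖v‖ := norm_pos_iff.2 hv0
    simp only [RCLike.norm_ofReal, abs_norm, ne_eq, ENNReal.ofReal_eq_zero, not_le]
    positivity

variable [IsProbabilityMeasure μ]

lemma avg_main (hM : IsRandomOrthonormal μ M) (J : Finset (Fin n)) (i : Fin n) (hi : i ∉ J)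
    (hN : 2 < dK K * Jᶜ.card) :
    (∫⁻ ω, (Dq (M ω) J (EuclideanSpace.single i 1))⁻¹ ∂μ) *
      ENNReal.ofReal (1 / ((dK K : ℝ) * (Jᶜ.card : ℝ) - 2)) =
    ∫⁻ ω, ∫⁻ g, (Dq (M ω) J (g : EuclideanSpace K (Fin n)))⁻¹ ∂(gK K (UU K Jᶜ)) ∂μ := by
  have hN' : 2 < dK K * Module.finrank K (UU K Jᶜ) := by rwa [finrank_UU]
  have hg := gK_inv K (UU K Jᶜ) hN'
  rw [finrank_UU] at hg
  have hmeas : Measurable (fun x : UU K Jᶜ => (ENNReal.ofReal (‖x‖ ^ 2))⁻¹) := by fun_prop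
  have hae : ∀ᵐ g ∂(gK K (UU K Jᶜ)), g ≠ 0 := by
    have := ae_lt_top hmeas (by rw [hg]; exact ENNReal.ofReal_ne_top)
    filter_upwards [this] with g hg h0
    simp [h0] at hg
  rw [lintegral_lintegral_swap]
  · rw [← hg, mul_comm, ← lintegral_mul_const _ hmeas]
    refine lintegral_congr_ae ?_
    filter_upwards [hae] with g h0
    rw [avg_vec hM J i hi g g.2 (by simpa using h0)]
    rfl
  · refine Measurable.aemeasurable ?_
    exact ((Dq_meas J).comp ((hM.1.comp measurable_fst).prodMk
      (measurable_subtype_coe.comp measurable_snd))).inv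

lemma avg_ne_zero (hM : IsRandomOrthonormal μ M) (J : Finset (Fin n)) (i : Fin n) (hi : i ∉ J)
    (hln : ℓ ≤ n) (m : ℕ) (hm : m + J.card = ℓ) (hd : 2 < dK K * m) :
    ∀ᵐ ω ∂μ, Dq (M ω) J (EuclideanSpace.single i 1) ≠ 0 := by
  have hcard : m ≤ Jᶜ.card := by
    rw [Finset.card_compl, Fintype.card_fin]; omega
  have hN : 2 < dK K * Jᶜ.card := hd.trans_le (Nat.mul_le_mul_left _ hcard)
  have h := avg_main hM J i hi hN
  have hle : ∫⁻ ω, ∫⁻ g, (Dq (M ω) J (g : EuclideanSpace K (Fin n)))⁻¹ ∂(gK K (UU K Jᶜ)) ∂μ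
      ≤ ∫⁻ ω, ENNReal.ofReal (1 / ((dK K : ℝ) * (m : ℝ) - 2)) ∂μ := by
    refine lintegral_mono_ae ?_
    filter_upwards [hM.2.2] with ω hω
    have h1 := (finrank_perp (M ω) J).1
    have h2 : m ≤ Module.finrank K ↥((UU K J).map (TT (M ω)))ᗮ := by omega
    have h3 : (2 : ℝ) < (dK K : ℝ) * m := by exact_mod_cast hd
    rw [Dq_gauss (M ω) hω J (hd.trans_le (Nat.mul_le_mul_left _ h2))]
    apply ENNReal.ofReal_le_ofReal
    apply one_div_le_one_div_of_le (by linarith)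
    gcongr
  rw [← h] at hle
  have hfin : ∫⁻ ω, (Dq (M ω) J (EuclideanSpace.single i 1))⁻¹ ∂μ ≠ ∞ := by
    intro htop
    rw [htop, ENNReal.top_mul] at hle
    · simp at hle
    · have h3 : (2 : ℝ) < (dK K : ℝ) * (Jᶜ.card : ℝ) := by exact_mod_cast hN
      simp only [ne_eq, ENNReal.ofReal_eq_zero, not_le]
      apply one_div_pos.2
      linarith
  have := ae_lt_top (((Dq_meas J).comp (hM.1.prodMk measurable_const)).inv) hfin
  filter_upwards [this] with ω hω h0
  simp [h0] at hω

lemma avg_value (hM : IsRandomOrthonormal μ M) (J : Finset (Fin n)) (i : Fin n) (hi : i ∉ J)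
    (hln : ℓ ≤ n) (m : ℕ) (hm : m + J.card = ℓ) (hd : 2 < dK K * m)
    (hinj : ∀ᵐ ω ∂μ, ∀ u ∈ UU K J, TT (M ω) u = 0 → u = 0) :
    ∫⁻ ω, (Dq (M ω) J (EuclideanSpace.single i 1))⁻¹ ∂μ =
      ENNReal.ofReal (((dK K : ℝ) * ((n : ℝ) - J.card) - 2) / ((dK K : ℝ) * (m : ℝ) - 2)) := by
  have hJn : J.card ≤ n := by omega
  have hcc : Jᶜ.card = n - J.card := by rw [Finset.card_compl, Fintype.card_fin]
  have hcard : m ≤ Jᶜ.card := by omega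
  have hN : 2 < dK K * Jᶜ.card := hd.trans_le (Nat.mul_le_mul_left _ hcard)
  have h := avg_main hM J i hi hN
  have he : ∫⁻ ω, ∫⁻ g, (Dq (M ω) J (g : EuclideanSpace K (Fin n)))⁻¹ ∂(gK K (UU K Jᶜ)) ∂μ
      = ∫⁻ ω, ENNReal.ofReal (1 / ((dK K : ℝ) * (m : ℝ) - 2)) ∂μ := by
    refine lintegral_congr_ae ?_
    filter_upwards [hM.2.2, hinj] with ω hω hi
    have h1 := (finrank_perp (M ω) J).2 hi
    have h2 : Module.finrank K ↥((UU K J).map (TT (M ω)))ᗮ = m := by omega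
    rw [Dq_gauss (M ω) hω J (by rw [h2]; exact hd), h2]
  rw [he, lintegral_const, measure_univ, mul_one] at h
  have h3 : (2 : ℝ) < (dK K : ℝ) * (Jᶜ.card : ℝ) := by exact_mod_cast hN
  have h4 : (2 : ℝ) < (dK K : ℝ) * m := by exact_mod_cast hd
  have h5 : ((Jᶜ.card : ℕ) : ℝ) = (n : ℝ) - J.card := by rw [hcc, Nat.cast_sub hJn]
  rw [← h5]
  have hpos : 0 < 1 / ((dK K : ℝ) * (Jᶜ.card : ℝ) - 2) := one_div_pos.2 (by linarith)
  rw [← ENNReal.mul_left_inj (c := ENNReal.ofReal (1 / ((dK K : ℝ) * (Jᶜ.card : ℝ) - 2)))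
    (by simpa using hpos) ENNReal.ofReal_ne_top, h, ← ENNReal.ofReal_mul]
  · congr 1
    have : (dK K : ℝ) * (Jᶜ.card : ℝ) - 2 ≠ 0 := by linarith
    field_simp
  · apply div_nonneg <;> linarith

end avg

/-! ### Part 5: pointwise matrix algebra -/

section mat
variable {K : Type*} [RCLike K] {r s ℓ : ℕ}

/-- squared Euclidean norm. -/
def nsq {ι : Type*} [Fintype ι] (w : ι → K) : ℝ := ∑ k, ‖w k‖ ^ 2

lemma nsq_nonneg {ι : Type*} [Fintype ι] (w : ι → K) : 0 ≤ nsq w :=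
  Finset.sum_nonneg fun _ _ => by positivity

lemma frobSq_eq {m n : Type*} [Fintype m] [Fintype n] (A : Matrix m n K) :
    frobSq A = ∑ i, nsq (A i) := rfl

lemma frobSq_nonneg {m n : Type*} [Fintype m] [Fintype n] (A : Matrix m n K) : 0 ≤ frobSq A :=
  Finset.sum_nonneg fun _ _ => nsq_nonneg _

lemma nsq_cs {ι : Type*} [Fintype ι] (v w : ι → K) : ‖v ⬝ᵥ w‖ ^ 2 ≤ nsq v * nsq w := by
  unfold nsq dotProduct
  calc ‖∑ k, v k * w k‖ ^ 2 ≤ (∑ k, ‖v k‖ * ‖w k‖) ^ 2 := by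
        gcongr
        refine (norm_sum_le _ _).trans (le_of_eq ?_)
        simp
    _ ≤ _ := Finset.sum_mul_sq_le_sq_mul_sq _ _ _

lemma frobSq_mul_le {a b c : Type*} [Fintype a] [Fintype b] [Fintype c]
    (A : Matrix a b K) (B : Matrix b c K) : frobSq (A * B) ≤ frobSq A * frobSq B := by
  rw [frobSq_eq A, Finset.sum_mul]
  unfold frobSq
  refine Finset.sum_le_sum fun i _ => ?_
  rw [Finset.sum_comm (f := fun i j => ‖B i j‖ ^ 2), Finset.mul_sum]
  refine Finset.sum_le_sum fun j _ => ?_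
  exact nsq_cs (A i) (fun k => B k j)

lemma nsq_eq_trace {m n : Type*} [Fintype m] [Fintype n] (A : Matrix m n K) (i : m) :
    ((nsq (A i) : ℝ) : K) = (A * Aᴴ) i i := by
  simp [nsq, Matrix.mul_apply, RCLike.mul_conj]

lemma frobSq_eq_trace {m n : Type*} [Fintype m] [Fintype n] (A : Matrix m n K) :
    ((frobSq A : ℝ) : K) = (A * Aᴴ).trace := by
  rw [frobSq_eq, Matrix.trace]
  push_cast
  exact Finset.sum_congr rfl fun i _ => nsq_eq_trace A i

lemma one_le_of_left_inv (A : Matrix (Fin ℓ) (Fin r) K) (Z : Matrix (Fin r) (Fin ℓ) K)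
    (h : Z * A = 1) (i : Fin r) (x : Fin r → K) (hx : x i = 1) :
    1 ≤ nsq (Z i) * nsq (A *ᵥ x) := by
  have h1 : Z i ⬝ᵥ (A *ᵥ x) = 1 := by
    have : (Z *ᵥ (A *ᵥ x)) i = x i := by rw [mulVec_mulVec, h, one_mulVec]
    rw [← hx, ← this]; rfl
  have := nsq_cs (Z i) (A *ᵥ x)
  rw [h1] at this
  simpa using this

lemma exists_of_MP (A : Matrix (Fin ℓ) (Fin r) K) (Z : Matrix (Fin r) (Fin ℓ) K)
    (h : Z * A = 1) (h2 : (A * Z)ᴴ = A * Z) (i : Fin r) :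
    ∃ x : Fin r → K, x i = 1 ∧ nsq (A *ᵥ x) * nsq (Z i) = 1 := by
  have hZ0 : nsq (Z i) ≠ 0 := by
    intro h0
    have := one_le_of_left_inv A Z h i (Pi.single i 1) (by simp)
    rw [h0] at this
    norm_num at this
  have hZK : ((nsq (Z i) : ℝ) : K) ≠ 0 := by exact_mod_cast hZ0
  have hA : A * (Z * Zᴴ) = Zᴴ := by
    have h3 : (Z * (A * Z))ᴴ = Zᴴ := by rw [← Matrix.mul_assoc, h, Matrix.one_mul]
    rw [conjTranspose_mul, h2, Matrix.mul_assoc] at h3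
    exact h3
  refine ⟨fun k => ((nsq (Z i) : ℝ) : K)⁻¹ * (Z * Zᴴ) k i, ?_, ?_⟩
  · simp only
    rw [← nsq_eq_trace, inv_mul_cancel₀ hZK]
  · have h4 : A *ᵥ (fun k => ((nsq (Z i) : ℝ) : K)⁻¹ * (Z * Zᴴ) k i)
        = fun k => ((nsq (Z i) : ℝ) : K)⁻¹ * Zᴴ k i := by
      ext k
      conv_rhs => rw [← hA]
      rw [Matrix.mul_apply, Finset.mul_sum]
      simp only [mulVec, dotProduct]
      refine Finset.sum_congr rfl fun j _ => ?_
      ring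
    have h5 : nsq (A *ᵥ (fun k => ((nsq (Z i) : ℝ) : K)⁻¹ * (Z * Zᴴ) k i))
        = (nsq (Z i))⁻¹ ^ 2 * nsq (Z i) := by
      have hc := nsq_nonneg (Z i)
      have hn : nsq (Z i) = ∑ k, ‖Z i k‖ ^ 2 := rfl
      rw [h4]
      generalize nsq (Z i) = c at hc hn ⊢
      conv_rhs => rw [hn, Finset.mul_sum, ← hn]
      unfold nsq
      refine Finset.sum_congr rfl fun k _ => ?_
      rw [norm_mul, norm_inv, RCLike.norm_ofReal, abs_of_nonneg hc, mul_pow, conjTranspose_apply,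
        norm_star]
    rw [h5]
    field_simp

lemma nsq_MP_le (A : Matrix (Fin ℓ) (Fin r) K) (P Z : Matrix (Fin r) (Fin ℓ) K)
    (h : P * A = 1) (h2 : (A * P)ᴴ = A * P) (hZ : Z * A = 1) (i : Fin r) :
    nsq (P i) ≤ nsq (Z i) := by
  obtain ⟨x, hx, hx'⟩ := exists_of_MP A P h h2 i
  have := one_le_of_left_inv A Z hZ i x hx
  calc nsq (P i) = 1 * nsq (P i) := by ring
    _ ≤ (nsq (Z i) * nsq (A *ᵥ x)) * nsq (P i) := by gcongr; exact nsq_nonneg _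
    _ = nsq (Z i) := by rw [mul_assoc, hx', mul_one]

lemma left_inv_of_inj (A : Matrix (Fin ℓ) (Fin r) K) (P : Matrix (Fin r) (Fin ℓ) K)
    (hinj : ∀ x, A *ᵥ x = 0 → x = 0) (h : A * P * A = A) : P * A = 1 := by
  rw [← sub_eq_zero]
  apply Matrix.ext_of_mulVec_single
  intro i
  rw [zero_mulVec]
  apply hinj
  rw [mulVec_mulVec, Matrix.mul_sub, ← Matrix.mul_assoc, h, Matrix.mul_one, sub_self, zero_mulVec]

lemma MP_formula (C : Matrix (Fin ℓ) (Fin r) K) (P : Matrix (Fin r) (Fin ℓ) K)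
    (h : P * C = 1) (h2 : (C * P)ᴴ = C * P) : P = (Cᴴ * C)⁻¹ * Cᴴ := by
  have h3 : P = (P * Pᴴ) * Cᴴ := by
    calc P = P * C * P := by rw [h, Matrix.one_mul]
      _ = P * (C * P)ᴴ := by rw [h2, Matrix.mul_assoc]
      _ = _ := by rw [conjTranspose_mul, Matrix.mul_assoc]
  have h4 : (P * Pᴴ) * (Cᴴ * C) = 1 := by
    rw [← Matrix.mul_assoc, ← h3, h]
  rw [Matrix.inv_eq_left_inv h4, ← h3]

/-- first rows, conjugate transposed. -/
def AA (Ω : Matrix (Fin (r + s)) (Fin ℓ) K) : Matrix (Fin ℓ) (Fin r) K :=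
  (Ω.submatrix (Fin.castAdd s) id)ᴴ

/-- last rows, conjugate transposed. -/
def BB (Ω : Matrix (Fin (r + s)) (Fin ℓ) K) : Matrix (Fin ℓ) (Fin s) K :=
  (Ω.submatrix (Fin.natAdd r) id)ᴴ

lemma AA_add_BB (Ω : Matrix (Fin (r + s)) (Fin ℓ) K) (h : Ωᴴ * Ω = 1) :
    AA Ω * (AA Ω)ᴴ + BB Ω * (BB Ω)ᴴ = 1 := by
  rw [← h]
  ext i j
  simp [AA, BB, Matrix.mul_apply, Fin.sum_univ_add]

lemma frob_split (Ω : Matrix (Fin (r + s)) (Fin ℓ) K) (h : Ωᴴ * Ω = 1)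
    (Z : Matrix (Fin r) (Fin ℓ) K) (hZ : Z * AA Ω = 1) :
    frobSq (Z * BB Ω) + r = frobSq Z := by
  have h1 : ((frobSq Z : ℝ) : K) = ((frobSq (Z * BB Ω) + r : ℝ) : K) := by
    rw [RCLike.ofReal_add, frobSq_eq_trace Z, frobSq_eq_trace (Z * BB Ω), RCLike.ofReal_natCast]
    have : Z * Zᴴ = (Z * BB Ω) * (Z * BB Ω)ᴴ + (Z * AA Ω) * (Z * AA Ω)ᴴ := by
      calc Z * Zᴴ = Z * (1 : Matrix (Fin ℓ) (Fin ℓ) K) * Zᴴ := by rw [Matrix.mul_one]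
        _ = _ := by
          rw [← AA_add_BB Ω h]
          simp only [conjTranspose_mul, Matrix.mul_add, Matrix.add_mul, Matrix.mul_assoc]
          rw [add_comm]
    rw [this, hZ, Matrix.trace_add]
    simp
  exact_mod_cast h1.symm

/-- embedding of `K^r` in the first coordinates. -/
def emb1 (s : ℕ) (x : Fin r → K) : EuclideanSpace K (Fin (r + s)) :=
  WithLp.toLp 2 (Fin.append x 0)

/-- embedding of `K^s` in the last coordinates. -/
def emb2 (r : ℕ) (x : Fin s → K) : EuclideanSpace K (Fin (r + s)) :=
  WithLp.toLp 2 (Fin.append 0 x)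

/-- the index set of the first `r` coordinates. -/
def J0 (r s : ℕ) : Finset (Fin (r + s)) := Finset.univ.map (Fin.castAddEmb s)

/-- the index set of the first `r` coordinates, `i` excluded. -/
def Ji (s : ℕ) (i : Fin r) : Finset (Fin (r + s)) := (Finset.univ.erase i).map (Fin.castAddEmb s)

lemma card_Ji (s : ℕ) (i : Fin r) : (Ji s i).card = r - 1 := by
  simp [Ji]

lemma not_mem_Ji (s : ℕ) (i : Fin r) : Fin.castAdd s i ∉ Ji s i := by
  simp [Ji]

lemma castAdd_mem_Ji (s : ℕ) (i j : Fin r) : Fin.castAdd s j ∈ Ji s i ↔ j ≠ i := by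
  simp [Ji]

lemma natAdd_not_mem_Ji (s : ℕ) (i : Fin r) (a : Fin s) : Fin.natAdd r a ∉ Ji s i := by
  simp only [Ji, Finset.mem_map, not_exists, not_and]
  intro x _ h
  have := congrArg Fin.val h
  simp at this
  omega

lemma natAdd_not_mem_J0 (a : Fin s) : Fin.natAdd r a ∉ J0 r s := by
  simp only [J0, Finset.mem_map, not_exists, not_and]
  intro x _ h
  have := congrArg Fin.val h
  simp at this
  omega

lemma castAdd_mem_J0 (j : Fin r) : Fin.castAdd s j ∈ J0 r s := by
  simp [J0]

lemma TT_emb1 (Ω : Matrix (Fin (r + s)) (Fin ℓ) K) (x : Fin r → K) :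
    TT Ω (emb1 s x) = WithLp.toLp 2 (AA Ω *ᵥ x) := by
  ext k
  simp [TT, emb1, AA, Matrix.toLpLin_apply, mulVec, dotProduct, Fin.sum_univ_add]

lemma TT_emb2 (Ω : Matrix (Fin (r + s)) (Fin ℓ) K) (x : Fin s → K) :
    TT Ω (emb2 r x) = WithLp.toLp 2 (BB Ω *ᵥ x) := by
  ext k
  simp [TT, emb2, BB, Matrix.toLpLin_apply, mulVec, dotProduct, Fin.sum_univ_add]

lemma norm_toLp_sq {ι : Type*} [Fintype ι] (w : ι → K) : ‖WithLp.toLp 2 w‖ ^ 2 = nsq w := by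
  rw [EuclideanSpace.norm_sq_eq]; rfl

lemma emb1_mem (x : Fin r → K) : emb1 s x ∈ UU K (J0 r s) := by
  intro j
  refine Fin.addCases (fun a h => absurd (castAdd_mem_J0 a) h) (fun a _ => ?_) j
  simp [emb1]

lemma emb2_mem (x : Fin s → K) : emb2 r x ∈ UU K (J0 r s)ᶜ := by
  intro j
  refine Fin.addCases (fun a h => ?_) (fun a h => ?_) j
  · simp [emb2]
  · exact absurd (by simpa using natAdd_not_mem_J0 a) h

lemma norm_emb2 (x : Fin s → K) : ‖emb2 r x‖ ^ 2 = nsq x := by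
  rw [emb2, norm_toLp_sq]
  simp [nsq, Fin.sum_univ_add]

lemma exists_emb1 (u : EuclideanSpace K (Fin (r + s))) (hu : u ∈ UU K (J0 r s)) :
    ∃ x : Fin r → K, u = emb1 s x := by
  refine ⟨fun j => u (Fin.castAdd s j), ?_⟩
  ext j
  refine Fin.addCases (fun a => ?_) (fun a => ?_) j
  · simp [emb1]
  · simp [emb1, hu _ (natAdd_not_mem_J0 a)]

lemma Ji_le (i : Fin r) : UU K (Ji s i) ≤ UU K (J0 r s) := by
  intro u hu j hj
  refine hu j fun h => hj ?_
  simp only [Ji, Finset.mem_map] at h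
  obtain ⟨a, _, rfl⟩ := h
  exact castAdd_mem_J0 a

lemma single_mem (i : Fin r) :
    EuclideanSpace.single (Fin.castAdd s i) (1 : K) ∈ UU K (J0 r s) := by
  intro j hj
  have : j ≠ Fin.castAdd s i := fun h => hj (h ▸ castAdd_mem_J0 i)
  simp [this]

lemma Dq_le (Ω : Matrix (Fin (r + s)) (Fin ℓ) K) (i : Fin r) (x : Fin r → K) (hx : x i = 1) :
    Dq Ω (Ji s i) (EuclideanSpace.single (Fin.castAdd s i) 1)
      ≤ ENNReal.ofReal (nsq (AA Ω *ᵥ x)) := by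
  have hm : emb1 s x - EuclideanSpace.single (Fin.castAdd s i) 1 ∈ UU K (Ji s i) := by
    intro j
    refine Fin.addCases (fun a h => ?_) (fun a h => ?_) j
    · have : a = i := by simpa [castAdd_mem_Ji] using h
      subst this
      simp [emb1, hx]
    · have : Fin.natAdd r a ≠ Fin.castAdd s i := fun h =>
        natAdd_not_mem_J0 (r := r) a (h ▸ castAdd_mem_J0 i)
      simp [emb1, this]
  refine (iInf_le _ ⟨_, hm⟩).trans (le_of_eq ?_)
  simp only [add_sub_cancel]
  rw [TT_emb1, norm_toLp_sq]

lemma le_Dq (Ω : Matrix (Fin (r + s)) (Fin ℓ) K) (i : Fin r) (c : ℝ≥0∞)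
    (h : ∀ x : Fin r → K, x i = 1 → c ≤ ENNReal.ofReal (nsq (AA Ω *ᵥ x))) :
    c ≤ Dq Ω (Ji s i) (EuclideanSpace.single (Fin.castAdd s i) 1) := by
  refine le_iInf fun u => ?_
  obtain ⟨x, hx⟩ := exists_emb1 _ (Submodule.add_mem _ (single_mem (K := K) (s := s) i)
    (Ji_le i u.2))
  rw [hx, TT_emb1, norm_toLp_sq]
  apply h
  have h1 := congrArg (fun v : EuclideanSpace K (Fin (r + s)) => v (Fin.castAdd s i)) hx
  have h2 := u.2 _ (not_mem_Ji s i)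
  simp [emb1, h2] at h1
  exact h1.symm

lemma inv_Dq_le (Ω : Matrix (Fin (r + s)) (Fin ℓ) K) (i : Fin r) (Z : Matrix (Fin r) (Fin ℓ) K)
    (hZ : Z * AA Ω = 1) :
    (Dq Ω (Ji s i) (EuclideanSpace.single (Fin.castAdd s i) 1))⁻¹ ≤ ENNReal.ofReal (nsq (Z i)) := by
  rw [ENNReal.inv_le_iff_inv_le]
  refine le_Dq Ω i _ fun x hx => ?_
  have h := one_le_of_left_inv _ Z hZ i x hx
  have hpos : 0 < nsq (Z i) := by
    refine lt_of_le_of_ne (nsq_nonneg _) fun h0 => ?_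
    rw [← h0] at h
    norm_num at h
  rw [← ENNReal.ofReal_inv_of_pos hpos]
  apply ENNReal.ofReal_le_ofReal
  rw [inv_le_iff_one_le_mul₀ hpos]
  linarith

lemma inv_Dq_eq (Ω : Matrix (Fin (r + s)) (Fin ℓ) K) (i : Fin r) (Z : Matrix (Fin r) (Fin ℓ) K)
    (hZ : Z * AA Ω = 1) (h2 : (AA Ω * Z)ᴴ = AA Ω * Z) :
    (Dq Ω (Ji s i) (EuclideanSpace.single (Fin.castAdd s i) 1))⁻¹ = ENNReal.ofReal (nsq (Z i)) := by
  refine le_antisymm (inv_Dq_le Ω i Z hZ) ?_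
  obtain ⟨x, hx, hx'⟩ := exists_of_MP _ Z hZ h2 i
  have hpos : 0 < nsq (Z i) := by
    refine lt_of_le_of_ne (nsq_nonneg _) fun h0 => ?_
    rw [← h0] at hx'
    norm_num at hx'
  rw [ENNReal.le_inv_iff_le_inv, ← ENNReal.ofReal_inv_of_pos hpos]
  refine (Dq_le Ω i x hx).trans (ENNReal.ofReal_le_ofReal (le_of_eq ?_))
  exact eq_inv_of_mul_eq_one_left hx'

lemma inj_of_Dq (Ω : Matrix (Fin (r + s)) (Fin ℓ) K)
    (h : ∀ i : Fin r, Dq Ω (Ji s i) (EuclideanSpace.single (Fin.castAdd s i) 1) ≠ 0) :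
    ∀ x, AA Ω *ᵥ x = 0 → x = 0 := by
  intro x hx
  ext i
  by_contra hi
  have hi : x i ≠ 0 := hi
  apply h i
  have := Dq_le Ω i ((x i)⁻¹ • x) (by simp [hi])
  rw [mulVec_smul, hx] at this
  simpa [nsq] using this

lemma inj_UU_of_inj (Ω : Matrix (Fin (r + s)) (Fin ℓ) K)
    (h : ∀ x, AA Ω *ᵥ x = 0 → x = 0) (i : Fin r) :
    ∀ u ∈ UU K (Ji s i), TT Ω u = 0 → u = 0 := by
  intro u hu hu0
  obtain ⟨x, rfl⟩ := exists_emb1 u (Ji_le i hu)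
  rw [TT_emb1] at hu0
  have : x = 0 := h x (by simpa using hu0)
  rw [this]
  ext j
  refine Fin.addCases (fun a => ?_) (fun a => ?_) j <;> simp [emb1]

end mat

/-! ### Part 6: the left inverse and its moments -/

section fin6
variable {K : Type*} [RCLike K] {r s ℓ : ℕ}

/-- The left inverse `(R* Ω₁*)⁺ R*`, by an explicit formula. -/
def Yf (R : Matrix (Fin ℓ) (Fin ℓ) K) (Ω : Matrix (Fin (r + s)) (Fin ℓ) K) :
    Matrix (Fin r) (Fin ℓ) K :=
  ((Rᴴ * AA Ω)ᴴ * (Rᴴ * AA Ω))⁻¹ * (Rᴴ * AA Ω)ᴴ * Rᴴ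

lemma Yf_spec (R : Matrix (Fin ℓ) (Fin ℓ) K) (hR : IsUnit R.det)
    (Ω : Matrix (Fin (r + s)) (Fin ℓ) K) (hinj : ∀ x, AA Ω *ᵥ x = 0 → x = 0)
    (P : Matrix (Fin r) (Fin ℓ) K) (hP : IsMoorePenrose (Rᴴ * AA Ω) P) :
    P * (Rᴴ * AA Ω) = 1 ∧ P * Rᴴ = Yf R Ω ∧ Yf R Ω * AA Ω = 1 := by
  have hRu : IsUnit (Rᴴ).det := by rw [det_conjTranspose]; exact hR.star
  have hinj' : ∀ x, (Rᴴ * AA Ω) *ᵥ x = 0 → x = 0 := by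
    intro x hx
    apply hinj
    have := congrArg (fun w => (Rᴴ)⁻¹ *ᵥ w) hx
    simpa [mulVec_mulVec, ← Matrix.mul_assoc, Matrix.nonsing_inv_mul _ hRu] using this
  have h1 := left_inv_of_inj _ P hinj' hP.1
  have h2 : P * Rᴴ = Yf R Ω := by
    unfold Yf
    rw [← MP_formula _ P h1 hP.2.2.1]
  refine ⟨h1, h2, ?_⟩
  rw [← h2, Matrix.mul_assoc, h1]

lemma Yf_one (Ω : Matrix (Fin (r + s)) (Fin ℓ) K) (hinj : ∀ x, AA Ω *ᵥ x = 0 → x = 0)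
    (P : Matrix (Fin r) (Fin ℓ) K)
    (hP : IsMoorePenrose ((1 : Matrix (Fin ℓ) (Fin ℓ) K)ᴴ * AA Ω) P) :
    Yf 1 Ω * AA Ω = 1 ∧ (AA Ω * Yf 1 Ω)ᴴ = AA Ω * Yf 1 Ω := by
  obtain ⟨_, h2, h3⟩ := Yf_spec 1 (by simp) Ω hinj P hP
  refine ⟨h3, ?_⟩
  rw [conjTranspose_one, Matrix.mul_one] at h2
  have h4 := hP.2.2.1
  rw [conjTranspose_one, Matrix.one_mul] at h4
  rw [← h2]
  exact h4

lemma frobSq_Yf_le (R : Matrix (Fin ℓ) (Fin ℓ) K) (hR : IsUnit R.det)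
    (Ω : Matrix (Fin (r + s)) (Fin ℓ) K) (hinj : ∀ x, AA Ω *ᵥ x = 0 → x = 0)
    (P : Matrix (Fin r) (Fin ℓ) K) (hP : IsMoorePenrose (Rᴴ * AA Ω) P)
    (Z : Matrix (Fin r) (Fin ℓ) K) (hZ : Z * AA Ω = 1) :
    frobSq (Yf R Ω) ≤ (frobSq ((Rᴴ)⁻¹) * frobSq Rᴴ) * frobSq Z := by
  have hRu : IsUnit (Rᴴ).det := by rw [det_conjTranspose]; exact hR.star
  obtain ⟨h1, h2, _⟩ := Yf_spec R hR Ω hinj P hP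
  have h3 : (Z * (Rᴴ)⁻¹) * (Rᴴ * AA Ω) = 1 := by
    rw [Matrix.mul_assoc, ← Matrix.mul_assoc _ Rᴴ, Matrix.nonsing_inv_mul _ hRu, Matrix.one_mul, hZ]
  have h4 : frobSq P ≤ frobSq (Z * (Rᴴ)⁻¹) :=
    Finset.sum_le_sum fun i _ => nsq_MP_le _ P _ h1 hP.2.2.1 h3 i
  have h5 := frobSq_mul_le Z ((Rᴴ)⁻¹)
  have h6 := frobSq_mul_le P Rᴴ
  rw [h2] at h6
  have h7 := frobSq_nonneg Rᴴ
  nlinarith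

lemma AA_rot (V : Matrix (Fin (r + s)) (Fin (r + s)) K) (Ω : Matrix (Fin (r + s)) (Fin ℓ) K)
    (h : ∀ u ∈ UU K (J0 r s), Matrix.toEuclideanLin Vᴴ u = u) : AA (V * Ω) = AA Ω := by
  apply Matrix.ext_of_mulVec_single
  intro i
  have h1 := TT_emb1 (V * Ω) (Pi.single i 1)
  rw [TT_mul, h _ (emb1_mem _), TT_emb1] at h1
  exact (WithLp.toLp_injective 2 h1).symm

lemma Yf_rot (R : Matrix (Fin ℓ) (Fin ℓ) K)
    (V : Matrix (Fin (r + s)) (Fin (r + s)) K) (Ω : Matrix (Fin (r + s)) (Fin ℓ) K)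
    (h : ∀ u ∈ UU K (J0 r s), Matrix.toEuclideanLin Vᴴ u = u) : Yf R (V * Ω) = Yf R Ω := by
  unfold Yf
  rw [AA_rot V Ω h]

lemma emb2_single (a : Fin s) :
    emb2 r (Pi.single a (1 : K)) = EuclideanSpace.single (Fin.natAdd r a) 1 := by
  ext j
  refine Fin.addCases (fun b => ?_) (fun b => ?_) j
  · have : Fin.castAdd s b ≠ Fin.natAdd r a := fun h =>
        natAdd_not_mem_J0 (r := r) a (h ▸ castAdd_mem_J0 b)
    simp [emb2, this]
  · simp [emb2, Pi.single_apply]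

lemma nsq_smul {ι : Type*} [Fintype ι] (c : K) (w : ι → K) : nsq (c • w) = ‖c‖ ^ 2 * nsq w := by
  simp [nsq, Finset.mul_sum, mul_pow]

lemma frobSq_cols {a b : Type*} [Fintype a] [Fintype b] (A : Matrix a b K) :
    frobSq A = ∑ j, nsq (fun i => A i j) := by
  unfold frobSq nsq
  rw [Finset.sum_comm]

lemma frobSq_one : frobSq (1 : Matrix (Fin s) (Fin s) K) = s := by
  simp [frobSq, Matrix.one_apply, apply_ite]

lemma nsq_cont {ι : Type*} [Fintype ι] : Continuous (nsq : (ι → K) → ℝ) := by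
  unfold nsq; fun_prop

lemma frobSq_cont {a b : Type*} [Fintype a] [Fintype b] :
    Continuous (frobSq : Matrix a b K → ℝ) := by
  unfold frobSq; fun_prop

variable [MeasurableSpace K] [BorelSpace K]

lemma meas_mul {X : Type*} [MeasurableSpace X] {a b c : ℕ}
    {f : X → Matrix (Fin a) (Fin b) K} {g : X → Matrix (Fin b) (Fin c) K}
    (hf : Measurable f) (hg : Measurable g) : Measurable (fun x => f x * g x) := by
  have : Continuous (fun p : Matrix (Fin a) (Fin b) K × Matrix (Fin b) (Fin c) K => p.1 * p.2) := by
    fun_prop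
  exact this.measurable.comp (hf.prodMk hg)

lemma meas_inv {a : ℕ} : Measurable (fun A : Matrix (Fin a) (Fin a) K => A⁻¹) := by
  simp only [Matrix.inv_def, Ring.inverse_eq_inv']
  have h : Continuous (fun p : K × Matrix (Fin a) (Fin a) K => p.1 • p.2) := by fun_prop
  have h1 : Measurable (fun A : Matrix (Fin a) (Fin a) K => (A.det)⁻¹) :=
    (Continuous.measurable (by fun_prop)).inv
  have h2 : Measurable (fun A : Matrix (Fin a) (Fin a) K => A.adjugate) :=
    Continuous.measurable (by fun_prop)
  exact h.measurable.comp (h1.prodMk h2)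

lemma AA_meas : Measurable (AA : Matrix (Fin (r + s)) (Fin ℓ) K → _) := by
  apply Continuous.measurable
  unfold AA
  fun_prop

lemma BB_meas : Measurable (BB : Matrix (Fin (r + s)) (Fin ℓ) K → _) := by
  apply Continuous.measurable
  unfold BB
  fun_prop

lemma Yf_meas (R : Matrix (Fin ℓ) (Fin ℓ) K) :
    Measurable (Yf R : Matrix (Fin (r + s)) (Fin ℓ) K → _) := by
  have h1 : Measurable (fun Ω : Matrix (Fin (r + s)) (Fin ℓ) K => Rᴴ * AA Ω) :=
    meas_mul measurable_const AA_meas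
  have h2 : Measurable (fun Ω : Matrix (Fin (r + s)) (Fin ℓ) K => (Rᴴ * AA Ω)ᴴ) :=
    (Continuous.measurable (f := fun A : Matrix (Fin ℓ) (Fin r) K => Aᴴ) (by fun_prop)).comp h1
  exact meas_mul (meas_mul (meas_inv.comp (meas_mul h2 h1)) h2) measurable_const

lemma frob_meas {X : Type*} [MeasurableSpace X] {a b : ℕ}
    {f : X → Matrix (Fin a) (Fin b) K} (hf : Measurable f) :
    Measurable (fun x => ENNReal.ofReal (frobSq (f x))) :=
  (frobSq_cont.measurable.comp hf).ennreal_ofReal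

lemma row_meas {X : Type*} [MeasurableSpace X] {a b : ℕ}
    {f : X → Matrix (Fin a) (Fin b) K} (hf : Measurable f) (i : Fin a) :
    Measurable (fun x => ENNReal.ofReal (nsq (f x i))) := by
  have : Continuous (fun A : Matrix (Fin a) (Fin b) K => nsq (A i)) :=
    nsq_cont.comp (continuous_apply i)
  exact (this.measurable.comp hf).ennreal_ofReal

lemma quad_meas (R : Matrix (Fin ℓ) (Fin ℓ) K) (b : Fin s → K) :
    Measurable (fun Ω : Matrix (Fin (r + s)) (Fin ℓ) K =>
      ENNReal.ofReal (nsq (Yf R Ω *ᵥ (BB Ω *ᵥ b)))) := by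
  have h : Continuous (fun A : Matrix (Fin r) (Fin s) K => nsq (A *ᵥ b)) :=
    nsq_cont.comp (by fun_prop)
  simp only [mulVec_mulVec]
  exact (h.measurable.comp (meas_mul (Yf_meas R) BB_meas)).ennreal_ofReal

variable {Y : Type*} [MeasurableSpace Y] {μ : Measure Y}
  {M : Y → Matrix (Fin (r + s)) (Fin ℓ) K}

lemma avgY (hM : IsRandomOrthonormal μ M) (R : Matrix (Fin ℓ) (Fin ℓ) K) (a : Fin s)
    (b : Fin s → K) :
    ∫⁻ ω, ENNReal.ofReal (nsq (Yf R (M ω) *ᵥ (BB (M ω) *ᵥ b))) ∂μ =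
      ENNReal.ofReal (nsq b) *
        ∫⁻ ω, ENNReal.ofReal (nsq (Yf R (M ω) *ᵥ (BB (M ω) *ᵥ (Pi.single a 1)))) ∂μ := by
  by_cases hb : nsq b = 0
  · have : b = 0 := by
      unfold nsq at hb
      rw [Finset.sum_eq_zero_iff_of_nonneg (fun _ _ => by positivity)] at hb
      ext k
      simpa using hb k (Finset.mem_univ k)
    subst this
    simp [nsq]
  have hb' : 0 < nsq b := lt_of_le_of_ne (nsq_nonneg _) (Ne.symm hb)
  set c : K := ((‖emb2 r b‖ : ℝ) : K)⁻¹ with hc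
  have hn : ‖emb2 r b‖ ≠ 0 := by
    intro h
    apply hb
    rw [← norm_emb2 (r := r), h]
    norm_num
  have hcn : ‖c‖ ^ 2 = (nsq b)⁻¹ := by
    rw [hc, norm_inv, RCLike.norm_ofReal, abs_norm, inv_pow, norm_emb2]
  have h2 : ‖c • emb2 r b‖ = 1 := by
    rw [hc, norm_smul, norm_inv, RCLike.norm_ofReal, abs_norm, inv_mul_cancel₀ hn]
  obtain ⟨V, hV, hV1, hV2⟩ := exists_rot (J0 r s) (Fin.natAdd r a) (natAdd_not_mem_J0 a)
    (c • emb2 r b) (Submodule.smul_mem _ _ (emb2_mem b)) h2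
  rw [← lint_rot hM (fun A => ENNReal.ofReal (nsq (Yf R A *ᵥ (BB A *ᵥ (Pi.single a 1)))))
    (quad_meas R _) V hV, ← lintegral_const_mul' _ _ ENNReal.ofReal_ne_top]
  refine lintegral_congr fun ω => ?_
  have h3 : BB (V * M ω) *ᵥ (Pi.single a 1) = c • (BB (M ω) *ᵥ b) := by
    have h4 := TT_emb2 (V * M ω) (Pi.single a 1)
    rw [TT_mul, emb2_single, hV2, map_smul, TT_emb2] at h4
    exact (WithLp.toLp_injective 2 h4).symm
  rw [Yf_rot R V _ hV1, h3, mulVec_smul, nsq_smul, ← ENNReal.ofReal_mul hb'.le, hcn,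
    mul_inv_cancel_left₀ hb]

lemma avgMat (hM : IsRandomOrthonormal μ M) (R : Matrix (Fin ℓ) (Fin ℓ) K) (a : Fin s) {q : ℕ}
    (C : Matrix (Fin s) (Fin q) K) :
    ∫⁻ ω, ENNReal.ofReal (frobSq (Yf R (M ω) * (BB (M ω) * C))) ∂μ =
      ENNReal.ofReal (frobSq C) *
        ∫⁻ ω, ENNReal.ofReal (nsq (Yf R (M ω) *ᵥ (BB (M ω) *ᵥ (Pi.single a 1)))) ∂μ := by
  have h1 : ∀ ω, ENNReal.ofReal (frobSq (Yf R (M ω) * (BB (M ω) * C))) =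
      ∑ j, ENNReal.ofReal (nsq (Yf R (M ω) *ᵥ (BB (M ω) *ᵥ (fun i => C i j)))) := by
    intro ω
    rw [frobSq_cols, ENNReal.ofReal_sum_of_nonneg fun _ _ => nsq_nonneg _]
    rfl
  simp only [h1]
  have h2 : ∀ j : Fin q, Measurable fun ω =>
      ENNReal.ofReal (nsq (Yf R (M ω) *ᵥ (BB (M ω) *ᵥ (fun i => C i j)))) :=
    fun j => (quad_meas R _).comp hM.1
  rw [lintegral_finsetSum _ (fun j _ => h2 j), frobSq_cols,
    ENNReal.ofReal_sum_of_nonneg fun _ _ => nsq_nonneg _, Finset.sum_mul]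
  exact Finset.sum_congr rfl fun j _ => avgY hM R a _

lemma avgMat' (hM : IsRandomOrthonormal μ M) (R : Matrix (Fin ℓ) (Fin ℓ) K) (a : Fin s) {q : ℕ}
    (C : Matrix (Fin s) (Fin q) K) :
    (s : ℝ≥0∞) * ∫⁻ ω, ENNReal.ofReal (frobSq (Yf R (M ω) * (BB (M ω) * C))) ∂μ =
      ENNReal.ofReal (frobSq C) *
        ∫⁻ ω, ENNReal.ofReal (frobSq (Yf R (M ω) * BB (M ω))) ∂μ := by
  have h1 := avgMat hM R a (1 : Matrix (Fin s) (Fin s) K)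
  simp only [Matrix.mul_one, frobSq_one, ENNReal.ofReal_natCast] at h1
  rw [avgMat hM R a C, h1]
  ring

variable [IsProbabilityMeasure μ]

lemma hd_aux (i : Fin r) (hr : (r : ℝ) + alphaK K < (ℓ : ℝ)) :
    r ≤ ℓ ∧ 2 < dK K * (ℓ + 1 - r) := by
  have ha : 0 ≤ alphaK K := by unfold alphaK; split_ifs <;> norm_num
  have h1 : r ≤ ℓ := by
    have : (r : ℝ) < ℓ := by linarith
    exact_mod_cast this.le
  refine ⟨h1, ?_⟩
  have h2 := dK_alpha K
  have h3 : (0 : ℝ) < dK K := by exact_mod_cast dK_pos K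
  have h4 : ((ℓ + 1 - r : ℕ) : ℝ) = ℓ + 1 - r := by
    rw [Nat.cast_sub (by omega)]; push_cast; ring
  have : (2 : ℝ) < (dK K : ℝ) * ((ℓ + 1 - r : ℕ) : ℝ) := by
    rw [h4, ← h2]
    apply mul_lt_mul_of_pos_left _ h3
    linarith
  exact_mod_cast this

lemma ae_inj (hM : IsRandomOrthonormal μ M) (hℓ : ℓ ≤ r + s)
    (hr : (r : ℝ) + alphaK K < (ℓ : ℝ)) :
    ∀ᵐ ω ∂μ, ∀ x, AA (M ω) *ᵥ x = 0 → x = 0 := by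
  have h : ∀ᵐ ω ∂μ, ∀ i : Fin r,
      Dq (M ω) (Ji s i) (EuclideanSpace.single (Fin.castAdd s i) 1) ≠ 0 := by
    rw [ae_all_iff]
    intro i
    obtain ⟨h1, h2⟩ := hd_aux i hr
    have hi := i.2
    exact avg_ne_zero hM _ _ (not_mem_Ji s i) hℓ (ℓ + 1 - r) (by rw [card_Ji]; omega) h2
  filter_upwards [h] with ω hω
  exact inj_of_Dq _ hω

lemma int_Dq (hM : IsRandomOrthonormal μ M) (hℓ : ℓ ≤ r + s)
    (hr : (r : ℝ) + alphaK K < (ℓ : ℝ)) (i : Fin r) :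
    ∫⁻ ω, (Dq (M ω) (Ji s i) (EuclideanSpace.single (Fin.castAdd s i) 1))⁻¹ ∂μ =
      ENNReal.ofReal ((s - alphaK K) / (ℓ - r - alphaK K)) := by
  obtain ⟨h1, h2⟩ := hd_aux i hr
  have hi := i.2
  rw [avg_value hM _ _ (not_mem_Ji s i) hℓ (ℓ + 1 - r) (by rw [card_Ji]; omega) h2]
  · congr 1
    have h2 := dK_alpha K
    have h3 : (0 : ℝ) < dK K := by exact_mod_cast dK_pos K
    have h4 : ((ℓ + 1 - r : ℕ) : ℝ) = ℓ + 1 - r := by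
      rw [Nat.cast_sub (by omega)]; push_cast; ring
    have h5 : ((r - 1 : ℕ) : ℝ) = r - 1 := by
      rw [Nat.cast_sub (by omega)]; push_cast; ring
    rw [card_Ji, h4, h5, ← h2]
    push_cast
    have e1 : (dK K : ℝ) * ((r + s : ℝ) - (r - 1)) - dK K * (1 + alphaK K)
      = dK K * (s - alphaK K) := by ring
    have e2 : (dK K : ℝ) * ((ℓ + 1 - r : ℝ)) - dK K * (1 + alphaK K)
      = dK K * (ℓ - r - alphaK K) := by ring
    rw [e1, e2, mul_div_mul_left _ _ h3.ne']
  · filter_upwards [ae_inj hM hℓ hr] with ω hω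
    exact inj_UU_of_inj _ hω i


lemma int_frob_eq (hM : IsRandomOrthonormal μ M) (R : Matrix (Fin ℓ) (Fin ℓ) K) :
    ∫⁻ ω, ENNReal.ofReal (frobSq (Yf R (M ω))) ∂μ =
      ∑ i : Fin r, ∫⁻ ω, ENNReal.ofReal (nsq (Yf R (M ω) i)) ∂μ := by
  have h2 : ∀ i : Fin r, Measurable fun ω => ENNReal.ofReal (nsq (Yf R (M ω) i)) :=
    fun i => row_meas ((Yf_meas R).comp hM.1) i
  rw [← lintegral_finsetSum _ (fun i _ => h2 i)]
  refine lintegral_congr fun ω => ?_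
  exact ENNReal.ofReal_sum_of_nonneg fun i _ => nsq_nonneg (Yf R (M ω) i)

lemma int_split
    (pinv : (m n : ℕ) → Matrix (Fin m) (Fin n) K → Matrix (Fin n) (Fin m) K)
    (hpinv : ∀ (m n : ℕ) (A : Matrix (Fin m) (Fin n) K), IsMoorePenrose A (pinv m n A))
    (hM : IsRandomOrthonormal μ M) (hℓ : ℓ ≤ r + s)
    (hr : (r : ℝ) + alphaK K < (ℓ : ℝ)) (R : Matrix (Fin ℓ) (Fin ℓ) K) (hR : IsUnit R.det) :
    ∫⁻ ω, ENNReal.ofReal (frobSq (Yf R (M ω) * BB (M ω))) ∂μ + r =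
      ∫⁻ ω, ENNReal.ofReal (frobSq (Yf R (M ω))) ∂μ := by
  have : ∫⁻ ω, (r : ℝ≥0∞) ∂μ = r := by simp
  rw [← this, ← lintegral_add_right _ measurable_const]
  refine lintegral_congr_ae ?_
  filter_upwards [ae_inj hM hℓ hr, hM.2.2] with ω h1 h2
  obtain ⟨_, _, h3⟩ := Yf_spec R hR _ h1 _ (hpinv _ _ _)
  rw [← frob_split _ h2 _ h3, ENNReal.ofReal_add (frobSq_nonneg _) (by positivity),
    ENNReal.ofReal_natCast]

lemma int_one
    (pinv : (m n : ℕ) → Matrix (Fin m) (Fin n) K → Matrix (Fin n) (Fin m) K)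
    (hpinv : ∀ (m n : ℕ) (A : Matrix (Fin m) (Fin n) K), IsMoorePenrose A (pinv m n A))
    (hM : IsRandomOrthonormal μ M) (hℓ : ℓ ≤ r + s)
    (hr : (r : ℝ) + alphaK K < (ℓ : ℝ)) :
    ∫⁻ ω, ENNReal.ofReal (frobSq (Yf 1 (M ω))) ∂μ =
      r * ENNReal.ofReal ((s - alphaK K) / (ℓ - r - alphaK K)) := by
  rw [int_frob_eq hM]
  have : ∀ i : Fin r, ∫⁻ ω, ENNReal.ofReal (nsq (Yf 1 (M ω) i)) ∂μ =
      ENNReal.ofReal ((s - alphaK K) / (ℓ - r - alphaK K)) := by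
    intro i
    rw [← int_Dq hM hℓ hr i]
    refine lintegral_congr_ae ?_
    filter_upwards [ae_inj hM hℓ hr] with ω h1
    obtain ⟨h2, h3⟩ := Yf_one _ h1 _ (hpinv _ _ _)
    exact (inv_Dq_eq _ i _ h2 h3).symm
  simp [this]

lemma int_ge
    (pinv : (m n : ℕ) → Matrix (Fin m) (Fin n) K → Matrix (Fin n) (Fin m) K)
    (hpinv : ∀ (m n : ℕ) (A : Matrix (Fin m) (Fin n) K), IsMoorePenrose A (pinv m n A))
    (hM : IsRandomOrthonormal μ M) (hℓ : ℓ ≤ r + s)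
    (hr : (r : ℝ) + alphaK K < (ℓ : ℝ)) (R : Matrix (Fin ℓ) (Fin ℓ) K) (hR : IsUnit R.det) :
    r * ENNReal.ofReal ((s - alphaK K) / (ℓ - r - alphaK K)) ≤
    ∫⁻ ω, ENNReal.ofReal (frobSq (Yf R (M ω))) ∂μ := by
  rw [int_frob_eq hM]
  have : ∀ i : Fin r, ENNReal.ofReal ((s - alphaK K) / (ℓ - r - alphaK K)) ≤
      ∫⁻ ω, ENNReal.ofReal (nsq (Yf R (M ω) i)) ∂μ := by
    intro i
    rw [← int_Dq hM hℓ hr i]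
    refine lintegral_mono_ae ?_
    filter_upwards [ae_inj hM hℓ hr] with ω h1
    obtain ⟨_, _, h3⟩ := Yf_spec R hR _ h1 _ (hpinv _ _ _)
    exact inv_Dq_le _ i _ h3
  calc _ = ∑ i : Fin r, ENNReal.ofReal ((s - alphaK K) / (ℓ - r - alphaK K)) := by simp
    _ ≤ _ := Finset.sum_le_sum fun i _ => this i

lemma int_fin
    (pinv : (m n : ℕ) → Matrix (Fin m) (Fin n) K → Matrix (Fin n) (Fin m) K)
    (hpinv : ∀ (m n : ℕ) (A : Matrix (Fin m) (Fin n) K), IsMoorePenrose A (pinv m n A))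
    (hM : IsRandomOrthonormal μ M) (hℓ : ℓ ≤ r + s)
    (hr : (r : ℝ) + alphaK K < (ℓ : ℝ)) (R : Matrix (Fin ℓ) (Fin ℓ) K) (hR : IsUnit R.det) :
    ∫⁻ ω, ENNReal.ofReal (frobSq (Yf R (M ω))) ∂μ ≠ ∞ := by
  have h : ∫⁻ ω, ENNReal.ofReal (frobSq (Yf R (M ω))) ∂μ ≤
      ENNReal.ofReal (frobSq ((Rᴴ)⁻¹) * frobSq Rᴴ) *
        ∫⁻ ω, ENNReal.ofReal (frobSq (Yf 1 (M ω))) ∂μ := by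
    rw [← lintegral_const_mul' _ _ ENNReal.ofReal_ne_top]
    refine lintegral_mono_ae ?_
    filter_upwards [ae_inj hM hℓ hr] with ω h1
    rw [← ENNReal.ofReal_mul (mul_nonneg (frobSq_nonneg _) (frobSq_nonneg _))]
    apply ENNReal.ofReal_le_ofReal
    exact frobSq_Yf_le R hR _ h1 _ (hpinv _ _ _) _ (Yf_one _ h1 _ (hpinv _ _ _)).1
  refine ne_top_of_le_ne_top ?_ h
  rw [int_one pinv hpinv hM hℓ hr]
  exact ENNReal.mul_ne_top ENNReal.ofReal_ne_top
    (ENNReal.mul_ne_top (by simp) ENNReal.ofReal_ne_top)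

lemma int_bochner
    (pinv : (m n : ℕ) → Matrix (Fin m) (Fin n) K → Matrix (Fin n) (Fin m) K)
    (hpinv : ∀ (m n : ℕ) (A : Matrix (Fin m) (Fin n) K), IsMoorePenrose A (pinv m n A))
    (hM : IsRandomOrthonormal μ M) (hℓ : ℓ ≤ r + s)
    (hr : (r : ℝ) + alphaK K < (ℓ : ℝ)) (R : Matrix (Fin ℓ) (Fin ℓ) K) (hR : IsUnit R.det)
    {p : ℕ} (B : Matrix (Fin s) (Fin p) K) :
    (s : ℝ) * ∫ ω, frobSq (pinv ℓ r (Rᴴ * AA (M ω)) * (Rᴴ * (BB (M ω) * B))) ∂μ =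
      frobSq B * ((∫⁻ ω, ENNReal.ofReal (frobSq (Yf R (M ω))) ∂μ).toReal - r) := by
  have ha : 0 ≤ alphaK K := by unfold alphaK; split_ifs <;> norm_num
  have hs : 0 < s := by
    have : (r : ℝ) < ℓ := by linarith
    have : r < ℓ := by exact_mod_cast this
    omega
  have h1 : ∫ ω, frobSq (pinv ℓ r (Rᴴ * AA (M ω)) * (Rᴴ * (BB (M ω) * B))) ∂μ =
      ∫ ω, frobSq (Yf R (M ω) * (BB (M ω) * B)) ∂μ := by
    refine integral_congr_ae ?_
    filter_upwards [ae_inj hM hℓ hr] with ω h1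
    obtain ⟨_, h2, _⟩ := Yf_spec R hR _ h1 _ (hpinv _ _ _)
    rw [← Matrix.mul_assoc, h2]
  have hmeas : Measurable (fun ω => frobSq (Yf R (M ω) * (BB (M ω) * B))) :=
    frobSq_cont.measurable.comp (meas_mul ((Yf_meas R).comp hM.1)
      (meas_mul (BB_meas.comp hM.1) measurable_const))
  rw [h1, integral_eq_lintegral_of_nonneg_ae (ae_of_all _ fun ω => frobSq_nonneg _)
    hmeas.aestronglyMeasurable]
  have h2 := congrArg ENNReal.toReal (avgMat' hM R ⟨0, hs⟩ B)
  rw [ENNReal.toReal_mul, ENNReal.toReal_mul, ENNReal.toReal_ofReal (frobSq_nonneg _),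
    ENNReal.toReal_natCast] at h2
  rw [h2]
  have h3 := int_split pinv hpinv hM hℓ hr R hR
  have h4 := int_fin pinv hpinv hM hℓ hr R hR
  have h5 : ∫⁻ ω, ENNReal.ofReal (frobSq (Yf R (M ω) * BB (M ω))) ∂μ ≠ ∞ := by
    intro h
    rw [← h3, h] at h4
    simp at h4
  rw [← h3, ENNReal.toReal_add h5 (by simp), ENNReal.toReal_natCast]
  ring

end fin6

/-- **Random orthonormal sketching identity** (Proposition 5.6): for a random
orthonormal embedding `Ω ∈ K^{(r+s)×ℓ}` partitioned into its first `r` rows `Ω₁` and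
last `s` rows `Ω₂`, with `r + α_K < ℓ`, any invertible `R` and any `B`,
`E‖(R*Ω₁*)⁺R*Ω₂*B‖_F² ≥ ((n − ℓ)/(n − r)) (r/(ℓ − r − α_K)) ‖B‖_F²` (for `n = r + s`),
with equality when `R = I`. -/
theorem orthonormal_sketching_identity
    {K : Type*} [RCLike K] [MeasurableSpace K] [BorelSpace K]
    {Y : Type*} [MeasurableSpace Y] (μ : Measure Y) [IsProbabilityMeasure μ]
    (pinv : (m n : ℕ) → Matrix (Fin m) (Fin n) K → Matrix (Fin n) (Fin m) K)
    (hpinv : ∀ (m n : ℕ) (A : Matrix (Fin m) (Fin n) K), IsMoorePenrose A (pinv m n A))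
    (r s ℓ p : ℕ) (hℓ : ℓ ≤ r + s)
    (M : Y → Matrix (Fin (r + s)) (Fin ℓ) K)
    (hM : IsRandomOrthonormal μ M)
    (hr : (r : ℝ) + alphaK K < (ℓ : ℝ))
    (B : Matrix (Fin s) (Fin p) K) :
    (∀ R : Matrix (Fin ℓ) (Fin ℓ) K, IsUnit R.det →
      (((r + s : ℕ) : ℝ) - (ℓ : ℝ)) / (((r + s : ℕ) : ℝ) - (r : ℝ)) *
          ((r : ℝ) / ((ℓ : ℝ) - (r : ℝ) - alphaK K)) * frobSq B ≤
        ∫ ω, frobSq (pinv ℓ r (Rᴴ * (((M ω).submatrix (Fin.castAdd s) id)ᴴ)) *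
          (Rᴴ * ((((M ω).submatrix (Fin.natAdd r) id)ᴴ) * B))) ∂μ) ∧
    ∫ ω, frobSq (pinv ℓ r ((1 : Matrix (Fin ℓ) (Fin ℓ) K)ᴴ *
          (((M ω).submatrix (Fin.castAdd s) id)ᴴ)) *
        ((1 : Matrix (Fin ℓ) (Fin ℓ) K)ᴴ *
          ((((M ω).submatrix (Fin.natAdd r) id)ᴴ) * B))) ∂μ
      = (((r + s : ℕ) : ℝ) - (ℓ : ℝ)) / (((r + s : ℕ) : ℝ) - (r : ℝ)) *
          ((r : ℝ) / ((ℓ : ℝ) - (r : ℝ) - alphaK K)) * frobSq B := by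
  have ha : 0 ≤ alphaK K := by unfold alphaK; split_ifs <;> norm_num
  have hrl : (r : ℝ) < ℓ := by linarith
  have hls : (ℓ : ℝ) ≤ r + s := by exact_mod_cast hℓ
  have hs : (0 : ℝ) < s := by linarith
  have hden : 0 < (ℓ : ℝ) - r - alphaK K := by linarith
  have hnum : 0 ≤ (s : ℝ) - alphaK K := by linarith
  have hc : 0 ≤ ((s : ℝ) - alphaK K) / (ℓ - r - alphaK K) := div_nonneg hnum hden.le
  have hval : (((r + s : ℕ) : ℝ) - (ℓ : ℝ)) / (((r + s : ℕ) : ℝ) - (r : ℝ)) *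
          ((r : ℝ) / ((ℓ : ℝ) - (r : ℝ) - alphaK K)) * frobSq B =
      (frobSq B * (r * (((s : ℝ) - alphaK K) / (ℓ - r - alphaK K)) - r)) / s := by
    push_cast
    rw [show (r : ℝ) + s - r = s by ring]
    field_simp
    ring
  have hto : ((r : ℝ≥0∞) * ENNReal.ofReal (((s : ℝ) - alphaK K) / (ℓ - r - alphaK K))).toReal =
      r * (((s : ℝ) - alphaK K) / (ℓ - r - alphaK K)) := by
    rw [ENNReal.toReal_mul, ENNReal.toReal_natCast, ENNReal.toReal_ofReal hc]
  constructor
  · intro R hR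
    have h1 := int_bochner pinv hpinv hM hℓ hr R hR B
    have h2 := ENNReal.toReal_mono (int_fin pinv hpinv hM hℓ hr R hR)
      (int_ge pinv hpinv hM hℓ hr R hR)
    rw [hto] at h2
    rw [hval, div_le_iff₀ hs, mul_comm _ (s : ℝ)]
    refine le_trans ?_ h1.symm.le
    exact mul_le_mul_of_nonneg_left (by linarith) (frobSq_nonneg _)
  · have h1 := int_bochner pinv hpinv hM hℓ hr 1 (by simp) B
    rw [int_one pinv hpinv hM hℓ hr, hto] at h1
    rw [hval, eq_div_iff hs.ne', mul_comm _ (s : ℝ)]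
    exact h1
end
end

section
/- Weighting hurts: for any matrix M ∈ K^{ℓ×r} and any invertible matrix R ∈ K^{ℓ×ℓ}, one has ‖M⁺‖_F² ≤ ‖(R*M)⁺ R*‖_F². -/
open MeasureTheory ProbabilityTheory Matrix Filter
open scoped ENNReal Topology ComplexOrder

noncomputable section

theorem frobSq_eq_re_trace {K : Type*} [RCLike K] {m n : Type*} [Fintype m] [Fintype n]
    (A : Matrix m n K) : frobSq A = RCLike.re (A * Aᴴ).trace := by
  simp only [frobSq, Matrix.trace, Matrix.diag, Matrix.mul_apply, Matrix.conjTranspose_apply,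
    map_sum]
  refine Finset.sum_congr rfl fun i _ => Finset.sum_congr rfl fun j _ => ?_
  rw [← starRingEnd_apply, RCLike.mul_conj]
  norm_cast

/-- **Weighting hurts** (Lemma 5.7): for any matrix `M ∈ K^{ℓ×r}` and any invertible
`R ∈ K^{ℓ×ℓ}`, `‖M⁺‖_F² ≤ ‖(R*M)⁺R*‖_F²`. -/
theorem weighting_hurts
    {K : Type*} [RCLike K]
    (pinv : (m n : ℕ) → Matrix (Fin m) (Fin n) K → Matrix (Fin n) (Fin m) K)
    (hpinv : ∀ (m n : ℕ) (A : Matrix (Fin m) (Fin n) K), IsMoorePenrose A (pinv m n A))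
    (ℓ r : ℕ)
    (M : Matrix (Fin ℓ) (Fin r) K) (R : Matrix (Fin ℓ) (Fin ℓ) K)
    (hR : IsUnit R.det) :
    frobSq (pinv ℓ r M) ≤ frobSq (pinv ℓ r (Rᴴ * M) * Rᴴ) := by
  obtain ⟨x1, x2, x3, x4⟩ := hpinv ℓ r M
  obtain ⟨y1, y2, y3, y4⟩ := hpinv ℓ r (Rᴴ * M)
  generalize pinv ℓ r M = X at *
  generalize pinv ℓ r (Rᴴ * M) = Y at *
  have hRH : IsUnit (Rᴴ).det := by
    rw [Matrix.det_conjTranspose]; exact hR.star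
  obtain ⟨G, hG⟩ : ∃ G, G = Y * Rᴴ := ⟨_, rfl⟩
  rw [← hG]
  have hGM : Y * (Rᴴ * M) = G * M := by rw [hG, Matrix.mul_assoc]
  rw [hGM] at y4
  have hM2 : M * (G * M) = M := by
    have h : Rᴴ * (M * (G * M)) = Rᴴ * M := by
      rw [← hGM]
      simpa only [Matrix.mul_assoc] using y1
    have h2 := congrArg (fun Z => (Rᴴ)⁻¹ * Z) h
    simpa only [Matrix.nonsing_inv_mul_cancel_left _ _ hRH] using h2
  have hQ12 : (X * M) * (G * M) = X * M := by rw [Matrix.mul_assoc, hM2]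
  have hQ21 : (G * M) * (X * M) = G * M := by
    rw [Matrix.mul_assoc, ← Matrix.mul_assoc M, x1]
  have hQ : X * M = G * M := by
    have h := congrArg Matrix.conjTranspose hQ12
    rw [Matrix.conjTranspose_mul, x4, y4, hQ21] at h
    exact h.symm
  have hX : X = G * (M * X) := by rw [← Matrix.mul_assoc, ← hQ, x2]
  have hPP : (M * X) * (M * X) = M * X := by rw [← Matrix.mul_assoc, x1]
  have hXX : X * Xᴴ = X * Gᴴ := by
    calc X * Xᴴ = (G * (M * X)) * (G * (M * X))ᴴ := by rw [← hX]
      _ = G * ((M * X) * (M * X)) * Gᴴ := by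
        rw [Matrix.conjTranspose_mul, x3]; simp only [Matrix.mul_assoc]
      _ = X * Gᴴ := by rw [hPP, ← hX]
  have hXX' : X * Xᴴ = G * Xᴴ := by
    have h := congrArg Matrix.conjTranspose hXX
    simpa using h
  have key : G * Gᴴ = X * Xᴴ + (G - X) * (G - X)ᴴ := by
    rw [Matrix.conjTranspose_sub, Matrix.sub_mul, Matrix.mul_sub, Matrix.mul_sub, ← hXX, ← hXX']
    abel
  have h3 : frobSq G = frobSq X + frobSq (G - X) := by
    rw [frobSq_eq_re_trace, frobSq_eq_re_trace, frobSq_eq_re_trace, key, Matrix.trace_add, map_add]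
  have h4 : 0 ≤ frobSq (G - X) :=
    Finset.sum_nonneg fun i _ => Finset.sum_nonneg fun j _ => sq_nonneg _
  linarith
end
end

section
/- Nyström approximation of a matrix with two distinct nonzero eigenvalues: let Ω ∈ K^{n×ℓ} be a random embedding that has full column rank almost surely and satisfies UΩ ~ Ω for each unitary U ∈ K^{n×n}. For positive numbers a, b > 0 and rank parameters q, r ∈ ℕ with q + α_K < ℓ ≤ r ≤ n, let H_{a,b} ∈ K^{n×n} be the diagonal psd matrix block-diag(a·I_q, b·I_{r−q}, 0_{n−r}), partitioned into the first q, the middle r − q, and the last n − r coordinates. Then lim_{a → ∞} E tr(H_{a,b} − H_{a,b}⟨Ω⟩) = b(r − ℓ)(1 + q/(ℓ − q − α_K)). -/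
open MeasureTheory ProbabilityTheory Matrix Filter
open scoped ENNReal Topology ComplexOrder

noncomputable section

/-- The psd matrix `H_{a,b} = blockdiag(a I_q, b I_{r−q}, 0_{n−r})`. -/
def twoEigMatrix (K : Type*) [RCLike K] (n q r : ℕ) (a b : ℝ) :
    Matrix (Fin n) (Fin n) K :=
  Matrix.diagonal fun i => if (i : ℕ) < q then (a : K) else if (i : ℕ) < r then (b : K) else 0


/-! ### Algebra of the Nyström residual -/

section Algebra

variable {K : Type*} [RCLike K] {n ℓ : ℕ}

/-- real diagonal matrix -/
def dg (K : Type*) [RCLike K] {n : ℕ} (d : Fin n → ℝ) : Matrix (Fin n) (Fin n) K :=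
  Matrix.diagonal fun i => (d i : K)

/-- The Nyström residual with the (junk valued) matrix inverse. -/
def res (d : Fin n → ℝ) (A : Matrix (Fin n) (Fin ℓ) K) : Matrix (Fin n) (Fin n) K :=
  dg K d - dg K d * A * ((Aᴴ * dg K d * A)⁻¹ * (Aᴴ * dg K d))

lemma dg_conjTranspose (d : Fin n → ℝ) : (dg K d)ᴴ = dg K d := by
  unfold dg
  rw [Matrix.diagonal_conjTranspose]
  congr 1
  ext i
  simp

lemma mulVec_inj_of_rank {A : Matrix (Fin n) (Fin ℓ) K} (hA : A.rank = ℓ) :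
    Function.Injective A.mulVec := by
  rw [Matrix.mulVec_injective_iff, linearIndependent_iff_card_eq_finrank_span]
  rw [Matrix.rank_eq_finrank_span_cols] at hA
  simp [Set.finrank, hA]

lemma rank_of_mulVec_inj {A : Matrix (Fin n) (Fin ℓ) K} (hA : Function.Injective A.mulVec) :
    A.rank = ℓ := by
  rw [Matrix.mulVec_injective_iff, linearIndependent_iff_card_eq_finrank_span] at hA
  rw [Matrix.rank_eq_finrank_span_cols]
  simpa [Set.finrank] using hA.symm

lemma gram_isUnit {d : Fin n → ℝ} (hd : ∀ i, 0 < d i) {A : Matrix (Fin n) (Fin ℓ) K}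
    (hA : A.rank = ℓ) : IsUnit (Aᴴ * dg K d * A).det := by
  have h1 : (dg K d).PosDef := by
    unfold dg
    rw [Matrix.posDef_diagonal_iff]
    intro i
    exact_mod_cast hd i
  have h2 := h1.conjTranspose_mul_mul_same (mulVec_inj_of_rank hA)
  exact (Matrix.isUnit_iff_isUnit_det _).mp h2.isUnit

lemma gram_conjTranspose (d : Fin n → ℝ) (A : Matrix (Fin n) (Fin ℓ) K) :
    (Aᴴ * dg K d * A)ᴴ = Aᴴ * dg K d * A := by
  simp [Matrix.conjTranspose_mul, dg_conjTranspose, Matrix.mul_assoc]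

lemma res_conjTranspose (d : Fin n → ℝ) (A : Matrix (Fin n) (Fin ℓ) K) :
    (res d A)ᴴ = res d A := by
  unfold res
  rw [Matrix.conjTranspose_sub, Matrix.conjTranspose_mul, Matrix.conjTranspose_mul,
    Matrix.conjTranspose_mul, Matrix.conjTranspose_mul, Matrix.conjTranspose_nonsing_inv,
    gram_conjTranspose]
  simp [dg_conjTranspose, Matrix.mul_assoc]

lemma res_mul_self {d : Fin n → ℝ} (hd : ∀ i, 0 < d i) {A : Matrix (Fin n) (Fin ℓ) K}
    (hA : A.rank = ℓ) : res d A * A = 0 := by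
  unfold res
  rw [Matrix.sub_mul]
  have : dg K d * A * ((Aᴴ * dg K d * A)⁻¹ * (Aᴴ * dg K d)) * A
      = dg K d * A * ((Aᴴ * dg K d * A)⁻¹ * (Aᴴ * dg K d * A)) := by
    simp only [Matrix.mul_assoc]
  rw [this, Matrix.nonsing_inv_mul _ (gram_isUnit hd hA)]
  simp

lemma conjTranspose_mul_res {d : Fin n → ℝ} (hd : ∀ i, 0 < d i) {A : Matrix (Fin n) (Fin ℓ) K}
    (hA : A.rank = ℓ) : Aᴴ * res d A = 0 := by
  have := congrArg Matrix.conjTranspose (res_mul_self hd hA)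
  rwa [Matrix.conjTranspose_mul, res_conjTranspose, Matrix.conjTranspose_zero] at this

/-- inverse diagonal -/
def dgi (K : Type*) [RCLike K] {n : ℕ} (d : Fin n → ℝ) : Matrix (Fin n) (Fin n) K :=
  dg K fun i => (d i)⁻¹

lemma dgi_mul_dg {d : Fin n → ℝ} (hd : ∀ i, 0 < d i) : dgi K d * dg K d = 1 := by
  unfold dgi dg
  rw [Matrix.diagonal_mul_diagonal, ← Matrix.diagonal_one]
  congr 1
  ext i
  rw [← RCLike.ofReal_mul, inv_mul_cancel₀ (hd i).ne']
  simp

lemma dg_mul_dgi {d : Fin n → ℝ} (hd : ∀ i, 0 < d i) : dg K d * dgi K d = 1 := by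
  unfold dgi dg
  rw [Matrix.diagonal_mul_diagonal, ← Matrix.diagonal_one]
  congr 1
  ext i
  rw [← RCLike.ofReal_mul, mul_inv_cancel₀ (hd i).ne']
  simp

/-- If `B` kills `A` then `B K R = B`. -/
lemma mul_dgi_res {d : Fin n → ℝ} (hd : ∀ i, 0 < d i) {p : ℕ} {A : Matrix (Fin n) (Fin ℓ) K}
    {B : Matrix (Fin p) (Fin n) K} (hB : B * A = 0) : B * dgi K d * res d A = B := by
  unfold res
  rw [Matrix.mul_sub, Matrix.mul_assoc, dgi_mul_dg hd, Matrix.mul_one]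
  have : B * dgi K d * (dg K d * A * ((Aᴴ * dg K d * A)⁻¹ * (Aᴴ * dg K d)))
      = B * (dgi K d * dg K d) * A * ((Aᴴ * dg K d * A)⁻¹ * (Aᴴ * dg K d)) := by
    simp only [Matrix.mul_assoc]
  rw [this, dgi_mul_dg hd, Matrix.mul_one, hB]
  simp

lemma res_dgi_mul {d : Fin n → ℝ} (hd : ∀ i, 0 < d i) {p : ℕ} {A : Matrix (Fin n) (Fin ℓ) K}
    {B : Matrix (Fin n) (Fin p) K} (hB : Aᴴ * B = 0) : res d A * dgi K d * B = B := by
  have h1 : Bᴴ * A = 0 := by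
    have := congrArg Matrix.conjTranspose hB
    rwa [Matrix.conjTranspose_mul, Matrix.conjTranspose_conjTranspose,
      Matrix.conjTranspose_zero] at this
  have := congrArg Matrix.conjTranspose (mul_dgi_res hd h1)
  rw [Matrix.conjTranspose_mul, Matrix.conjTranspose_mul, res_conjTranspose,
    Matrix.conjTranspose_conjTranspose] at this
  unfold dgi at this ⊢
  rw [dg_conjTranspose] at this
  rw [Matrix.mul_assoc]
  exact this

lemma res_idem {d : Fin n → ℝ} (hd : ∀ i, 0 < d i) {A : Matrix (Fin n) (Fin ℓ) K}
    (hA : A.rank = ℓ) : res d A * dgi K d * res d A = res d A :=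
  mul_dgi_res hd (res_mul_self hd hA)

/-- commutator identity -/
lemma res_comm {d : Fin n → ℝ} (hd : ∀ i, 0 < d i) {A : Matrix (Fin n) (Fin ℓ) K}
    (hA : A.rank = ℓ) {U : Matrix (Fin n) (Fin n) K} (hU : U ∈ Matrix.unitaryGroup (Fin n) K)
    (hUA : (U * A).rank = ℓ) :
    res d (U * A) * U - U * res d A =
      res d (U * A) * (U * dgi K d - dgi K d * U) * res d A := by
  have h1 : res d (U * A) * U * dgi K d * res d A = res d (U * A) * U := by
    apply mul_dgi_res hd
    rw [Matrix.mul_assoc]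
    exact res_mul_self hd hUA
  have h2 : res d (U * A) * dgi K d * (U * res d A) = U * res d A := by
    apply res_dgi_mul hd
    have hu : Uᴴ * U = 1 := Matrix.mem_unitaryGroup_iff'.mp hU
    rw [Matrix.conjTranspose_mul, Matrix.mul_assoc, ← Matrix.mul_assoc Uᴴ, hu, Matrix.one_mul]
    exact conjTranspose_mul_res hd hA
  rw [Matrix.mul_sub, Matrix.sub_mul, ← Matrix.mul_assoc, h1, ← Matrix.mul_assoc,
    Matrix.mul_assoc _ U, h2]

lemma dgi_apply_mul (d : Fin n → ℝ) (R S : Matrix (Fin n) (Fin n) K) (i j : Fin n) :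
    (R * dgi K d * S) i j = ∑ p, R i p * ((d p)⁻¹ : ℝ) * S p j := by
  unfold dgi dg
  rw [Matrix.mul_apply]
  simp [Matrix.mul_diagonal]

/-- diagonal entries -/
def rho (d : Fin n → ℝ) (A : Matrix (Fin n) (Fin ℓ) K) (i : Fin n) : ℝ := RCLike.re (res d A i i)

lemma res_symm (d : Fin n → ℝ) (A : Matrix (Fin n) (Fin ℓ) K) (i j : Fin n) :
    res d A i j = star (res d A j i) := by
  conv_lhs => rw [← res_conjTranspose]
  rfl

lemma rho_eq (d : Fin n → ℝ) (A : Matrix (Fin n) (Fin ℓ) K) (i : Fin n) :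
    res d A i i = (rho d A i : K) := by
  have := res_symm d A i i
  unfold rho
  exact (RCLike.conj_eq_iff_re.mp this.symm).symm

lemma norm_symm (d : Fin n → ℝ) (A : Matrix (Fin n) (Fin ℓ) K) (i j : Fin n) :
    ‖res d A i j‖ = ‖res d A j i‖ := by
  rw [res_symm, norm_star]

lemma rho_sum {d : Fin n → ℝ} (hd : ∀ i, 0 < d i) {A : Matrix (Fin n) (Fin ℓ) K}
    (hA : A.rank = ℓ) (i : Fin n) : rho d A i = ∑ p, (d p)⁻¹ * ‖res d A i p‖ ^ 2 := by
  have h := congrFun (congrFun (res_idem hd hA) i) i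
  rw [dgi_apply_mul, rho_eq] at h
  have h2 : (∑ p, res d A i p * ((d p)⁻¹ : ℝ) * res d A p i : K)
      = ((∑ p, (d p)⁻¹ * ‖res d A i p‖ ^ 2 : ℝ) : K) := by
    rw [RCLike.ofReal_sum]
    refine Finset.sum_congr rfl fun p _ => ?_
    rw [res_symm d A p i]
    have := RCLike.mul_conj (res d A i p)
    rw [RCLike.star_def, mul_right_comm, this]
    push_cast
    ring
  rw [h2] at h
  exact_mod_cast h.symm

lemma norm_sq_le {d : Fin n → ℝ} (hd : ∀ i, 0 < d i) {A : Matrix (Fin n) (Fin ℓ) K}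
    (hA : A.rank = ℓ) (i p : Fin n) : ‖res d A i p‖ ^ 2 ≤ d p * rho d A i := by
  have h : (d p)⁻¹ * ‖res d A i p‖ ^ 2 ≤ rho d A i := by
    rw [rho_sum hd hA i]
    exact Finset.single_le_sum (f := fun p => (d p)⁻¹ * ‖res d A i p‖ ^ 2)
      (fun p _ => by have := hd p; positivity) (Finset.mem_univ p)
  rwa [inv_mul_le_iff₀ (hd p)] at h

lemma rho_nonneg {d : Fin n → ℝ} (hd : ∀ i, 0 < d i) {A : Matrix (Fin n) (Fin ℓ) K}
    (hA : A.rank = ℓ) (i : Fin n) : 0 ≤ rho d A i := by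
  rw [rho_sum hd hA i]
  exact Finset.sum_nonneg (fun p _ => by have := hd p; positivity)

lemma rho_le {d : Fin n → ℝ} (hd : ∀ i, 0 < d i) {A : Matrix (Fin n) (Fin ℓ) K}
    (hA : A.rank = ℓ) (i : Fin n) : rho d A i ≤ d i := by
  have h := norm_sq_le hd hA i i
  have h0 := rho_nonneg hd hA i
  rw [rho_eq, RCLike.norm_ofReal, sq_abs] at h
  by_contra hc
  push Not at hc
  have := hd i
  nlinarith

lemma norm_le_of_le {d : Fin n → ℝ} (hd : ∀ i, 0 < d i) {A : Matrix (Fin n) (Fin ℓ) K}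
    (hA : A.rank = ℓ) {C : ℝ} (hC : ∀ i, d i ≤ C) (i p : Fin n) : ‖res d A i p‖ ≤ C := by
  have h := norm_sq_le hd hA i p
  have h0 := rho_nonneg hd hA i
  have h1 := rho_le hd hA i
  have hC0 : 0 ≤ C := (hd i).le.trans (hC i)
  have : ‖res d A i p‖ ^ 2 ≤ C ^ 2 := by
    have := hC p; have := hC i; have := hd p
    nlinarith
  exact abs_le_of_sq_le_sq' this hC0 |>.2

lemma norm_sq_le_rho {d : Fin n → ℝ} (hd : ∀ i, 0 < d i) {A : Matrix (Fin n) (Fin ℓ) K}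
    (hA : A.rank = ℓ) (i j : Fin n) : ‖res d A i j‖ ^ 2 ≤ rho d A i * rho d A j := by
  have h := congrFun (congrFun (res_idem hd hA) i) j
  rw [dgi_apply_mul] at h
  have h1 : ‖res d A i j‖ ≤ ∑ p, (√((d p)⁻¹) * ‖res d A i p‖) * (√((d p)⁻¹) * ‖res d A j p‖) := by
    rw [← h]
    refine (norm_sum_le _ _).trans (Finset.sum_le_sum fun p _ => ?_)
    have h3 : 0 ≤ (d p)⁻¹ := inv_nonneg.mpr (hd p).le
    have h4 := Real.mul_self_sqrt h3
    rw [norm_mul, norm_mul, RCLike.norm_ofReal, abs_of_nonneg h3, norm_symm d A p j]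
    refine le_of_eq ?_
    linear_combination -(‖res d A i p‖ * ‖res d A j p‖) * h4
  have h2 := Finset.sum_mul_sq_le_sq_mul_sq Finset.univ
    (fun p => √((d p)⁻¹) * ‖res d A i p‖) (fun p => √((d p)⁻¹) * ‖res d A j p‖)
  have h5 : ∀ i, ∑ p, (√((d p)⁻¹) * ‖res d A i p‖) ^ 2 = rho d A i := by
    intro i
    rw [rho_sum hd hA i]
    refine Finset.sum_congr rfl fun p _ => ?_
    rw [mul_pow, Real.sq_sqrt (inv_nonneg.mpr (hd p).le)]
  rw [h5, h5] at h2
  exact (pow_le_pow_left₀ (norm_nonneg _) h1 2).trans h2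

lemma trace_sum {d : Fin n → ℝ} (hd : ∀ i, 0 < d i) {A : Matrix (Fin n) (Fin ℓ) K}
    (hA : A.rank = ℓ) : ∑ i, (d i)⁻¹ * rho d A i = (n : ℝ) - ℓ := by
  have h : Matrix.trace (dgi K d * res d A) = (n : K) - ℓ := by
    unfold res
    rw [Matrix.mul_sub, dgi_mul_dg hd]
    have : dgi K d * (dg K d * A * ((Aᴴ * dg K d * A)⁻¹ * (Aᴴ * dg K d)))
      = (dgi K d * dg K d) * A * ((Aᴴ * dg K d * A)⁻¹ * (Aᴴ * dg K d)) := by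
      simp only [Matrix.mul_assoc]
    rw [this, dgi_mul_dg hd, Matrix.one_mul, Matrix.trace_sub, Matrix.trace_mul_comm A,
      Matrix.mul_assoc, Matrix.nonsing_inv_mul _ (gram_isUnit hd hA)]
    simp
  have h2 : Matrix.trace (dgi K d * res d A) = ((∑ i, (d i)⁻¹ * rho d A i : ℝ) : K) := by
    unfold Matrix.trace
    rw [RCLike.ofReal_sum]
    refine Finset.sum_congr rfl fun p _ => ?_
    rw [RCLike.ofReal_mul, ← rho_eq]
    simp [dgi, dg]
  rw [h2] at h
  exact_mod_cast h

lemma rho_mono {d d' : Fin n → ℝ} (hd : ∀ i, 0 < d i) (hdd : ∀ i, d i ≤ d' i)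
    {A : Matrix (Fin n) (Fin ℓ) K} (hA : A.rank = ℓ) (i : Fin n) : rho d A i ≤ rho d' A i := by
  have hd' : ∀ i, 0 < d' i := fun i => (hd i).trans_le (hdd i)
  set R := res d A with hR
  set S := res d' A with hS
  have e1 : S * dgi K d' * S = S := res_idem hd' hA
  have e2 : S * dgi K d' * R = R := res_dgi_mul hd' (conjTranspose_mul_res hd hA)
  have e3 : R * dgi K d' * S = R := mul_dgi_res hd' (res_mul_self hd hA)
  have e4 : R * dgi K d * R = R := res_idem hd hA
  have key : S - R = (S - R) * dgi K d' * (S - R) + (R * dgi K d * R - R * dgi K d' * R) := by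
    simp only [Matrix.sub_mul, Matrix.mul_sub, e1, e2, e3, e4]
    abel
  have hz : ∀ p, (S - R) p i = star ((S - R) i p) := by
    intro p
    simp only [Matrix.sub_apply, star_sub, hR, hS]
    rw [res_symm d A p i, res_symm d' A p i]
  have h := congrArg RCLike.re (congrFun (congrFun key i) i)
  rw [Matrix.add_apply, Matrix.sub_apply, Matrix.sub_apply, dgi_apply_mul, dgi_apply_mul,
    dgi_apply_mul, ← Finset.sum_sub_distrib, map_add, map_sub, map_sum, map_sum] at h
  have n1 : 0 ≤ ∑ p, RCLike.re ((S - R) i p * (((d' p)⁻¹ : ℝ) : K) * (S - R) p i) := by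
    refine Finset.sum_nonneg fun p _ => ?_
    rw [hz p, mul_right_comm, RCLike.star_def, RCLike.mul_conj, ← RCLike.ofReal_pow,
      ← RCLike.ofReal_mul, RCLike.ofReal_re]
    have := hd' p
    positivity
  have n2 : 0 ≤ ∑ p, RCLike.re (R i p * (((d p)⁻¹ : ℝ) : K) * R p i
      - R i p * (((d' p)⁻¹ : ℝ) : K) * R p i) := by
    refine Finset.sum_nonneg fun p _ => ?_
    rw [hR, res_symm d A p i, mul_right_comm _ (((d p)⁻¹ : ℝ) : K),
      mul_right_comm _ (((d' p)⁻¹ : ℝ) : K), RCLike.star_def, RCLike.mul_conj,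
      ← RCLike.ofReal_pow, ← RCLike.ofReal_mul, ← RCLike.ofReal_mul, ← RCLike.ofReal_sub,
      RCLike.ofReal_re]
    have := inv_anti₀ (hd p) (hdd p)
    nlinarith [sq_nonneg ‖res d A i p‖]
  unfold rho
  linarith

end Algebra

section Rotation

variable {K : Type*} [RCLike K] {n ℓ : ℕ}

/-- plane rotation with phase -/
def rot (i j : Fin n) (c s : ℝ) (z : K) : Matrix (Fin n) (Fin n) K :=
  1 + (((c - 1 : ℝ) : K) • (Matrix.single i i 1 + Matrix.single j j 1) +
    (s : K) • (z • Matrix.single j i 1 - star z • Matrix.single i j 1))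

lemma rot_mem {i j : Fin n} (hij : i ≠ j) {c s : ℝ} (hcs : c ^ 2 + s ^ 2 = 1) {z : K}
    (hz : star z * z = 1) : rot i j c s z ∈ Matrix.unitaryGroup (Fin n) K := by
  rw [Matrix.mem_unitaryGroup_iff', Matrix.star_eq_conjTranspose]
  have hcs' : (c : K) ^ 2 + (s : K) ^ 2 = 1 := by exact_mod_cast hcs
  have e1 : (rot i j c s z)ᴴ = 1 + (((c - 1 : ℝ) : K) • (Matrix.single i i 1 + Matrix.single j j 1) +
    (s : K) • (star z • Matrix.single i j 1 - z • Matrix.single j i 1)) := by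
    simp [rot, Matrix.conjTranspose_add, Matrix.conjTranspose_sub, Matrix.conjTranspose_smul,
      Matrix.conjTranspose_single]
  rw [e1]
  unfold rot
  have hij' := hij.symm
  simp only [Matrix.mul_add, Matrix.add_mul, Matrix.mul_sub, Matrix.sub_mul, Matrix.smul_mul,
    Matrix.mul_smul, Matrix.one_mul, Matrix.mul_one, Matrix.single_mul_single_same,
    Matrix.single_mul_single_of_ne _ _ _ _ hij, Matrix.single_mul_single_of_ne _ _ _ _ hij', mul_one, smul_add, smul_sub, smul_zero, smul_smul]
  match_scalars
  · simp
  all_goals push_cast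
  · linear_combination (s : K) ^ 2 * hz + hcs'
  · linear_combination (s : K) ^ 2 * hz + hcs'
  · ring
  · ring

lemma rot_comm (d : Fin n → ℝ) (i j : Fin n) (c s : ℝ) (z : K) :
    rot i j c s z * dgi K d - dgi K d * rot i j c s z =
      ((s * ((d i)⁻¹ - (d j)⁻¹) : ℝ) : K) • (z • Matrix.single j i 1 + star z • Matrix.single i j 1) := by
  unfold rot dgi dg
  ext p k
  have h1 : ∀ (a b : Fin n), (if a = p ∧ b = k then (1 : K) else 0) * ((d k)⁻¹ : ℝ)
      = (if a = p ∧ b = k then (1 : K) else 0) * ((d b)⁻¹ : ℝ) := by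
    intro a b
    split_ifs with h
    · rw [h.2]
    · simp
  have h2 : ∀ (a b : Fin n), (if a = p ∧ b = k then (1 : K) else 0) * ((d p)⁻¹ : ℝ)
      = (if a = p ∧ b = k then (1 : K) else 0) * ((d a)⁻¹ : ℝ) := by
    intro a b
    split_ifs with h
    · rw [h.1]
    · simp
  have h3 : (if p = k then (1 : K) else 0) * ((d p)⁻¹ : ℝ)
      = (if p = k then (1 : K) else 0) * ((d k)⁻¹ : ℝ) := by
    split_ifs with h
    · rw [h]
    · simp
  have a1 := h1 i i
  have a2 := h1 i j
  have a3 := h1 j i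
  have a4 := h1 j j
  have b1 := h2 i i
  have b2 := h2 i j
  have b3 := h2 j i
  have b4 := h2 j j
  simp only [Matrix.single_apply, Matrix.one_apply, Matrix.diagonal_mul, Matrix.mul_diagonal,
    Matrix.add_apply, Matrix.sub_apply, Matrix.smul_apply, smul_eq_mul]
  generalize (if p = k then (1 : K) else 0) = x0 at *
  generalize (if i = p ∧ i = k then (1 : K) else 0) = x1 at *
  generalize (if i = p ∧ j = k then (1 : K) else 0) = x2 at *
  generalize (if j = p ∧ i = k then (1 : K) else 0) = x3 at *
  generalize (if j = p ∧ j = k then (1 : K) else 0) = x4 at *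
  push_cast at *
  linear_combination (-1) * h3 + ((c : K) - 1) * (a1 - b1) + ((c : K) - 1) * (a4 - b4)
    + (s : K) * (z * (a3 - b3) - star z * (a2 - b2))

lemma rot_entry {i j : Fin n} (hij : i ≠ j) (c s : ℝ) (z : K) (R S : Matrix (Fin n) (Fin n) K) :
    (S * rot i j c s z - rot i j c s z * R) i j
      = c * (S i j - R i j) - s * star z * (S i i - R j j) := by
  have hij' := hij.symm
  simp [rot, Matrix.mul_add, Matrix.add_mul, Matrix.mul_sub, Matrix.sub_mul, hij, hij', RCLike.real_smul_eq_coe_mul]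
  ring

lemma rot_entry' {i j : Fin n} (hij : i ≠ j) (c s : ℝ) (z : K) (R S : Matrix (Fin n) (Fin n) K) :
    (S * rot i j c s z - rot i j c s z * R) i i
      = c * (S i i - R i i) + s * (z * S i j + star z * R j i) := by
  have hij' := hij.symm
  simp [rot, Matrix.mul_add, Matrix.add_mul, Matrix.mul_sub, Matrix.sub_mul, hij, hij', RCLike.real_smul_eq_coe_mul]
  ring

lemma mid_entry0 (i j p k : Fin n) (R S : Matrix (Fin n) (Fin n) K) :
    (S * Matrix.single j i (1 : K) * R : Matrix (Fin n) (Fin n) K) p k = S p j * R i k := by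
  rw [Matrix.mul_apply, Finset.sum_eq_single i]
  · simp
  · intro b _ hb
    simp [hb]
  · simp

lemma mid_entry (i j p k : Fin n) (t z : K) (R S : Matrix (Fin n) (Fin n) K) :
    (S * (t • (z • Matrix.single j i (1 : K) + star z • Matrix.single i j (1 : K))) * R :
        Matrix (Fin n) (Fin n) K) p k
      = t * (z * S p j * R i k + star z * S p i * R j k) := by
  simp only [Matrix.mul_add, Matrix.add_mul, Matrix.smul_mul, Matrix.mul_smul, Matrix.smul_apply,
    Matrix.add_apply, mid_entry0, smul_eq_mul]
  ring

/-- exact finite rotation identities -/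
lemma rot_id1 {d : Fin n → ℝ} (hd : ∀ i, 0 < d i) {A : Matrix (Fin n) (Fin ℓ) K}
    (hA : A.rank = ℓ) {i j : Fin n} (hij : i ≠ j) {c s : ℝ} (hcs : c ^ 2 + s ^ 2 = 1) {z : K}
    (hz : star z * z = 1) (hUA : (rot i j c s z * A).rank = ℓ) :
    (c : K) * (res d (rot i j c s z * A) i j - res d A i j)
      - s * star z * (res d (rot i j c s z * A) i i - res d A j j) =
      ((s * ((d i)⁻¹ - (d j)⁻¹) : ℝ) : K) *
      (z * res d (rot i j c s z * A) i j * res d A i j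
        + star z * res d (rot i j c s z * A) i i * res d A j j) := by
  have h := res_comm hd hA (rot_mem hij hcs hz) hUA
  rw [rot_comm] at h
  have h1 := congrFun (congrFun h i) j
  rwa [rot_entry hij, mid_entry] at h1

lemma rot_id2 {d : Fin n → ℝ} (hd : ∀ i, 0 < d i) {A : Matrix (Fin n) (Fin ℓ) K}
    (hA : A.rank = ℓ) {i j : Fin n} (hij : i ≠ j) {c s : ℝ} (hcs : c ^ 2 + s ^ 2 = 1) {z : K}
    (hz : star z * z = 1) (hUA : (rot i j c s z * A).rank = ℓ) :
    (c : K) * (res d (rot i j c s z * A) i i - res d A i i)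
      + s * (z * res d (rot i j c s z * A) i j + star z * res d A j i) =
      ((s * ((d i)⁻¹ - (d j)⁻¹) : ℝ) : K) *
      (z * res d (rot i j c s z * A) i j * res d A i i
        + star z * res d (rot i j c s z * A) i i * res d A j i) := by
  have h := res_comm hd hA (rot_mem hij hcs hz) hUA
  rw [rot_comm] at h
  have h1 := congrFun (congrFun h i) i
  rwa [rot_entry' hij, mid_entry] at h1

lemma rank_unitary_mul {A : Matrix (Fin n) (Fin ℓ) K} {U : Matrix (Fin n) (Fin n) K}
    (hU : U ∈ Matrix.unitaryGroup (Fin n) K) : (U * A).rank = A.rank := by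
  apply Matrix.rank_mul_eq_right_of_isUnit_det
  rw [← Matrix.isUnit_iff_isUnit_det]
  exact ⟨⟨U, star U, Matrix.mem_unitaryGroup_iff.mp hU, Matrix.mem_unitaryGroup_iff'.mp hU⟩, rfl⟩

end Rotation

section Meas

variable {K : Type*} [RCLike K] [MeasurableSpace K] [BorelSpace K]
  {Y : Type*} [MeasurableSpace Y] {n ℓ m p : ℕ}

/-- entrywise measurability -/
def EM (F : Y → Matrix (Fin m) (Fin n) K) : Prop := ∀ i j, Measurable fun y => F y i j

lemma EM.const (A : Matrix (Fin m) (Fin n) K) : EM (fun _ : Y => A) :=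
  fun _ _ => measurable_const

lemma EM.mul {F : Y → Matrix (Fin m) (Fin n) K} {G : Y → Matrix (Fin n) (Fin p) K}
    (hF : EM F) (hG : EM G) : EM fun y => F y * G y := by
  intro i j
  simp only [Matrix.mul_apply]
  exact Finset.measurable_sum _ fun k _ => (hF i k).mul (hG k j)

lemma EM.sub {F G : Y → Matrix (Fin m) (Fin n) K}
    (hF : EM F) (hG : EM G) : EM fun y => F y - G y := by
  intro i j
  simp only [Matrix.sub_apply]
  exact (hF i j).sub (hG i j)

lemma EM.conjTranspose {F : Y → Matrix (Fin m) (Fin n) K}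
    (hF : EM F) : EM fun y => (F y)ᴴ := by
  intro i j
  simp only [Matrix.conjTranspose_apply]
  exact continuous_star.measurable.comp (hF j i)

lemma EM.det {F : Y → Matrix (Fin n) (Fin n) K} (hF : EM F) : Measurable fun y => (F y).det := by
  simp only [Matrix.det_apply']
  exact Finset.measurable_sum _ fun s _ => (Finset.measurable_prod _ fun k _ => hF _ _).const_mul _

lemma EM.inv {F : Y → Matrix (Fin n) (Fin n) K} (hF : EM F) : EM fun y => (F y)⁻¹ := by
  intro i j
  simp only [Matrix.inv_def, Matrix.smul_apply, smul_eq_mul, Ring.inverse_eq_inv']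
  refine (hF.det.inv).mul ?_
  simp only [Matrix.adjugate_apply]
  apply EM.det
  intro a b
  by_cases h : a = j
  · subst h
    simp
  · simpa [Matrix.updateRow_apply, h] using hF a b

lemma EM.of_measurable {F : Y → Matrix (Fin m) (Fin n) K} (hF : Measurable F) : EM F :=
  fun i j => (measurable_pi_apply j).comp ((measurable_pi_apply i).comp hF)

lemma EM.res {F : Y → Matrix (Fin n) (Fin ℓ) K} (hF : EM F) (d : Fin n → ℝ) :
    EM fun y => res d (F y) := by
  unfold _root_.res
  exact (EM.const _).sub (((EM.const _).mul hF).mul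
    (((hF.conjTranspose.mul (EM.const _)).mul hF).inv.mul (hF.conjTranspose.mul (EM.const _))))

lemma EM.measurable {F : Y → Matrix (Fin m) (Fin n) K} (hF : EM F) : Measurable F :=
  measurable_pi_lambda _ fun i => measurable_pi_lambda _ fun j => hF i j

lemma res_meas (d : Fin n → ℝ) (i j : Fin n) :
    Measurable fun A : Matrix (Fin n) (Fin ℓ) K => res d A i j :=
  EM.res (EM.of_measurable measurable_id) d i j

lemma re_meas : Measurable (RCLike.re : K → ℝ) := RCLike.continuous_re.measurable

lemma rho_meas (d : Fin n → ℝ) (i : Fin n) :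
    Measurable fun A : Matrix (Fin n) (Fin ℓ) K => rho d A i :=
  re_meas.comp (res_meas d i i)

lemma integral_rot (μ : Measure Y) {M : Y → Matrix (Fin n) (Fin ℓ) K} (hM : Measurable M)
    (hMrot : RotationInvariant μ M) {U : Matrix (Fin n) (Fin n) K}
    (hU : U ∈ Matrix.unitaryGroup (Fin n) K) {f : Matrix (Fin n) (Fin ℓ) K → ℝ}
    (hf : Measurable f) : ∫ ω, f (U * M ω) ∂μ = ∫ ω, f (M ω) ∂μ := by
  have hUM : Measurable fun ω => U * M ω := ((EM.const U).mul (EM.of_measurable hM)).measurable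
  rw [← integral_map (μ := μ) hM.aemeasurable hf.aestronglyMeasurable,
    ← integral_map (μ := μ) (φ := fun ω => U * M ω) hUM.aemeasurable hf.aestronglyMeasurable,
    hMrot U hU]

end Meas

section Point

variable {K : Type*} [RCLike K] {n ℓ : ℕ}

/-- quadratic observable -/
def obs (i j : Fin n) (z : K) (S R : Matrix (Fin n) (Fin n) K) : ℝ :=
  RCLike.re (z * z * S i j * R i j) + RCLike.re (S i i) * RCLike.re (R j j)

lemma pt_id {d : Fin n → ℝ} (hd : ∀ i, 0 < d i) {A : Matrix (Fin n) (Fin ℓ) K}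
    (hA : A.rank = ℓ) {i j : Fin n} (hij : i ≠ j) {c s : ℝ} (hcs : c ^ 2 + s ^ 2 = 1) {z : K}
    (hz : star z * z = 1) :
    c * (RCLike.re (z * res d (rot i j c s z * A) i j) - RCLike.re (z * res d A i j))
      - s * (rho d (rot i j c s z * A) i - rho d A j) =
      s * ((d i)⁻¹ - (d j)⁻¹) * obs i j z (res d (rot i j c s z * A)) (res d A) := by
  have hUA : (rot i j c s z * A).rank = ℓ := by rw [rank_unitary_mul (rot_mem hij hcs hz), hA]
  have h := rot_id1 hd hA hij hcs hz hUA
  rw [rho_eq, rho_eq] at h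
  unfold obs
  rw [rho_eq, rho_eq, RCLike.ofReal_re, RCLike.ofReal_re]
  generalize res d (rot i j c s z * A) i j = S at *
  generalize res d A i j = R at *
  generalize rho d (rot i j c s z * A) i = x at *
  generalize rho d A j = y at *
  have h2 : (c : K) * (z * S - z * R) - ((s * (x - y) : ℝ) : K) =
      ((s * ((d i)⁻¹ - (d j)⁻¹) : ℝ) : K) * (z * z * S * R + ((x * y : ℝ) : K)) := by
    push_cast at h ⊢
    linear_combination z * h + (s * (x - y) + (s * ((d i : K)⁻¹ - (d j : K)⁻¹)) * (x * y)) * hz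
  have h3 := congrArg RCLike.re h2
  simp only [map_sub, map_add, RCLike.re_ofReal_mul, RCLike.ofReal_re] at h3
  linarith

lemma norm_of_unit {z : K} (hz : star z * z = 1) : ‖z‖ = 1 := by
  have h := congrArg norm hz
  rw [norm_mul, norm_star, norm_one] at h
  nlinarith [norm_nonneg z]

lemma pt_aux {C s c κ : ℝ} (hs : 0 < s) (hc : 1 / 2 ≤ c) {x y z1 z2 w1 w2 w3 w4 : K}
    (h : (c : K) * x + s * (z1 * w1 + z2 * w2) = ((s * κ : ℝ) : K) * (z1 * w1 * w3 + z2 * y * w4))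
    (hz1 : ‖z1‖ = 1) (hz2 : ‖z2‖ = 1) (h1 : ‖w1‖ ≤ C) (h2 : ‖w2‖ ≤ C) (h3 : ‖w3‖ ≤ C)
    (h4 : ‖w4‖ ≤ C) (hy : ‖y‖ ≤ C) : ‖x‖ ≤ s * (4 * C + 4 * |κ| * C ^ 2) := by
  have hC : 0 ≤ C := (norm_nonneg _).trans h1
  have e : (c : K) * x = ((s * κ : ℝ) : K) * (z1 * w1 * w3 + z2 * y * w4)
    - s * (z1 * w1 + z2 * w2) := by linear_combination h
  have e2 := congrArg norm e
  rw [norm_mul, RCLike.norm_ofReal, abs_of_nonneg (by linarith)] at e2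
  have b1 : ‖z1 * w1 * w3 + z2 * y * w4‖ ≤ C * C + C * C := by
    refine (norm_add_le _ _).trans ?_
    rw [norm_mul, norm_mul, norm_mul, norm_mul, hz1, hz2, one_mul, one_mul]
    gcongr
  have b2 : ‖z1 * w1 + z2 * w2‖ ≤ C + C := by
    refine (norm_add_le _ _).trans ?_
    rw [norm_mul, norm_mul, hz1, hz2, one_mul, one_mul]
    gcongr
  have b3 : c * ‖x‖ ≤ s * |κ| * (C * C + C * C) + s * (C + C) := by
    rw [e2]
    refine (norm_sub_le _ _).trans ?_
    rw [norm_mul, norm_mul, RCLike.norm_ofReal, RCLike.norm_ofReal, abs_mul, abs_of_pos hs]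
    gcongr
  nlinarith [norm_nonneg x]

lemma pt_bd {d : Fin n → ℝ} (hd : ∀ i, 0 < d i) {A : Matrix (Fin n) (Fin ℓ) K}
    (hA : A.rank = ℓ) {i j : Fin n} (hij : i ≠ j) {c s : ℝ} (hcs : c ^ 2 + s ^ 2 = 1) {z : K}
    (hz : star z * z = 1) (hs : 0 < s) (hc : 1 / 2 ≤ c) {C : ℝ} (hC : ∀ i, d i ≤ C) :
    |obs i j z (res d (rot i j c s z * A)) (res d A) - obs i j z (res d A) (res d A)|
      ≤ s * (2 * C * (4 * C + 4 * |(d i)⁻¹ - (d j)⁻¹| * C ^ 2)) := by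
  have hUA : (rot i j c s z * A).rank = ℓ := by rw [rank_unitary_mul (rot_mem hij hcs hz), hA]
  have hz1 := norm_of_unit hz
  have hz2 : ‖star z‖ = 1 := by rw [norm_star, hz1]
  have h1 := rot_id1 hd hA hij hcs hz hUA
  have h2 := rot_id2 hd hA hij hcs hz hUA
  have hn := fun i p => norm_le_of_le hd hA hC i p
  have hn' := fun i p => norm_le_of_le hd hUA hC i p
  have hC0 : 0 ≤ C := (norm_nonneg _).trans (hn i j)
  have k2 := pt_aux hs hc h2 hz1 hz2 (hn' i j) (hn j i) (hn i i) (hn j i) (hn' i i)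
  have k1 : ‖res d (rot i j c s z * A) i j - res d A i j‖
      ≤ s * (4 * C + 4 * |(d i)⁻¹ - (d j)⁻¹| * C ^ 2) := by
    refine pt_aux (z1 := star z) (z2 := -star z) (w1 := - res d (rot i j c s z * A) i i)
      (w2 := - res d A j j) (w3 := - res d A j j) (w4 := res d A i j)
      (y := - (z * z) * res d (rot i j c s z * A) i j) (κ := (d i)⁻¹ - (d j)⁻¹) hs hc ?_ hz2 (by rw [norm_neg, hz2])
      (by rw [norm_neg]; exact hn' i i) (by rw [norm_neg]; exact hn j j)
      (by rw [norm_neg]; exact hn j j) (hn i j) ?_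
    · linear_combination h1 + (((s * ((d i)⁻¹ - (d j)⁻¹) : ℝ) : K) * (-1) * z * res d (rot i j c s z * A) i j * res d A i j) * hz
    · rw [norm_mul, norm_neg, norm_mul, hz1]
      simpa using hn' i j
  set L := s * (4 * C + 4 * |(d i)⁻¹ - (d j)⁻¹| * C ^ 2)
  have e : obs i j z (res d (rot i j c s z * A)) (res d A) - obs i j z (res d A) (res d A)
      = RCLike.re (z * z * (res d (rot i j c s z * A) i j - res d A i j) * res d A i j)
        + RCLike.re (res d (rot i j c s z * A) i i - res d A i i) * RCLike.re (res d A j j) := by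
    unfold obs
    rw [mul_sub, sub_mul, map_sub, map_sub]
    ring
  rw [e]
  have t1 : |RCLike.re (z * z * (res d (rot i j c s z * A) i j - res d A i j) * res d A i j)|
      ≤ L * C := by
    refine (RCLike.abs_re_le_norm _).trans ?_
    rw [norm_mul, norm_mul, norm_mul, hz1, one_mul, one_mul]
    have := hn i j
    gcongr
  have t2 : |RCLike.re (res d (rot i j c s z * A) i i - res d A i i) * RCLike.re (res d A j j)|
      ≤ L * C := by
    rw [abs_mul]
    have u1 := (RCLike.abs_re_le_norm (res d (rot i j c s z * A) i i - res d A i i)).trans k2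
    have u2 := (RCLike.abs_re_le_norm (res d A j j)).trans (hn j j)
    gcongr
  refine (abs_add_le _ _).trans ?_
  have : s * (2 * C * (4 * C + 4 * |(d i)⁻¹ - (d j)⁻¹| * C ^ 2)) = L * C + L * C := by
    simp only [L]; ring
  linarith

end Point

section Pair

variable {K : Type*} [RCLike K] [MeasurableSpace K] [BorelSpace K]
  {Y : Type*} [MeasurableSpace Y] {n ℓ : ℕ}

lemma integrable_bd (μ : Measure Y) [IsProbabilityMeasure μ] {f : Y → ℝ} (hf : Measurable f)
    {C : ℝ} (h : ∀ᵐ ω ∂μ, |f ω| ≤ C) : Integrable f μ :=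
  Integrable.of_bound hf.aestronglyMeasurable C h

lemma isub {μ : Measure Y} {f g : Y → ℝ} (hf : Integrable f μ) (hg : Integrable g μ) :
    Integrable (fun ω => f ω - g ω) μ := hf.sub hg

lemma iadd {μ : Measure Y} {f g : Y → ℝ} (hf : Integrable f μ) (hg : Integrable g μ) :
    Integrable (fun ω => f ω + g ω) μ := hf.add hg

lemma eq_zero_of_small {x D : ℝ} (h : ∀ s : ℝ, 0 < s → s ≤ 1 / 2 → |x| ≤ s * D) : x = 0 := by
  have h1 : Tendsto (fun s : ℝ => s * D) (𝓝[>] 0) (𝓝 (0 * D)) :=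
    ((continuous_id.mul continuous_const).tendsto 0).mono_left nhdsWithin_le_nhds
  have h2 : |x| ≤ 0 * D := by
    refine ge_of_tendsto h1 ?_
    filter_upwards [Ioc_mem_nhdsGT (show (0 : ℝ) < 1 / 2 by norm_num)] with s hs
    exact h s hs.1 hs.2
  rw [zero_mul] at h2
  exact abs_nonpos_iff.mp h2

variable (μ : Measure Y) [IsProbabilityMeasure μ]
    {M : Y → Matrix (Fin n) (Fin ℓ) K}

lemma rho_integrable (hMmeas : Measurable M) (hMfull : ∀ᵐ ω ∂μ, (M ω).rank = ℓ)
    {d : Fin n → ℝ} (hd : ∀ i, 0 < d i) (i : Fin n) : Integrable (fun ω => rho d (M ω) i) μ := by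
  refine integrable_bd μ ((rho_meas d i).comp hMmeas) (C := d i) ?_
  filter_upwards [hMfull] with ω hω
  rw [abs_of_nonneg (rho_nonneg hd hω i)]
  exact rho_le hd hω i

lemma obs_meas {F G : Y → Matrix (Fin n) (Fin n) K} (hF : EM F) (hG : EM G) (i j : Fin n) (z : K) :
    Measurable fun ω => obs i j z (F ω) (G ω) := by
  unfold obs
  exact (re_meas.comp (((hF i j).const_mul _).mul (hG i j))).add
    ((re_meas.comp (hF i i)).mul (re_meas.comp (hG j j)))

lemma obs_bd {C : ℝ} {i j : Fin n} {z : K} (hz : ‖z‖ = 1) {S R : Matrix (Fin n) (Fin n) K}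
    (hS : ∀ i j, ‖S i j‖ ≤ C) (hR : ∀ i j, ‖R i j‖ ≤ C) : |obs i j z S R| ≤ C * C + C * C := by
  have hC : 0 ≤ C := (norm_nonneg _).trans (hS i j)
  unfold obs
  refine (abs_add_le _ _).trans (add_le_add ?_ ?_)
  · refine (RCLike.abs_re_le_norm _).trans ?_
    rw [norm_mul, norm_mul, norm_mul, hz, one_mul, one_mul]
    exact mul_le_mul (hS i j) (hR i j) (norm_nonneg _) hC
  · rw [abs_mul]
    exact mul_le_mul ((RCLike.abs_re_le_norm _).trans (hS i i))
      ((RCLike.abs_re_le_norm _).trans (hR j j)) (abs_nonneg _) hC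

lemma pair_id (hMmeas : Measurable M) (hMfull : ∀ᵐ ω ∂μ, (M ω).rank = ℓ)
    (hMrot : RotationInvariant μ M)
    {d : Fin n → ℝ} (hd : ∀ i, 0 < d i) {i j : Fin n} (hij : i ≠ j) {z : K}
    (hz : star z * z = 1) :
    ∫ ω, rho d (M ω) i ∂μ - ∫ ω, rho d (M ω) j ∂μ
      + ((d i)⁻¹ - (d j)⁻¹) * ∫ ω, obs i j z (res d (M ω)) (res d (M ω)) ∂μ = 0 := by
  obtain ⟨C, hC⟩ : ∃ C, ∀ i, d i ≤ C :=
    ⟨∑ i, d i, fun i => Finset.single_le_sum (fun i _ => (hd i).le) (Finset.mem_univ i)⟩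
  set κ := (d i)⁻¹ - (d j)⁻¹ with hκ
  refine eq_zero_of_small (D := |κ| * (2 * C * (4 * C + 4 * |κ| * C ^ 2))) fun s hs0 hs1 => ?_
  set c := √(1 - s ^ 2) with hc
  have hs2 : 0 ≤ 1 - s ^ 2 := by nlinarith
  have hcs : c ^ 2 + s ^ 2 = 1 := by rw [hc, Real.sq_sqrt hs2]; ring
  have hc2 : 1 / 2 ≤ c := by
    apply Real.le_sqrt_of_sq_le
    nlinarith
  have hU : rot i j c s z ∈ Matrix.unitaryGroup (Fin n) K := rot_mem hij hcs hz
  have hz1 := norm_of_unit hz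
  have hUmeas : Measurable fun ω => rot i j c s z * M ω :=
    ((EM.const _).mul (EM.of_measurable hMmeas)).measurable
  have hUfull : ∀ᵐ ω ∂μ, (rot i j c s z * M ω).rank = ℓ := by
    filter_upwards [hMfull] with ω hω
    rw [rank_unitary_mul hU, hω]
  -- integrability
  have fm : Measurable fun A : Matrix (Fin n) (Fin ℓ) K => RCLike.re (z * res d A i j) :=
    re_meas.comp ((res_meas d i j).const_mul z)
  have fint : ∀ N : Y → Matrix (Fin n) (Fin ℓ) K, Measurable N → (∀ᵐ ω ∂μ, (N ω).rank = ℓ) →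
      Integrable (fun ω => RCLike.re (z * res d (N ω) i j)) μ := by
    intro N hN hNf
    refine integrable_bd μ (fm.comp hN) (C := C) ?_
    filter_upwards [hNf] with ω hω
    refine (RCLike.abs_re_le_norm _).trans ?_
    rw [norm_mul, hz1, one_mul]
    exact norm_le_of_le hd hω hC i j
  have I1 := fint _ hUmeas hUfull
  have I2 := fint _ hMmeas hMfull
  have I3 := rho_integrable μ hUmeas hUfull hd i
  have I4 := rho_integrable μ hMmeas hMfull hd j
  have J1 : Integrable (fun ω => obs i j z (res d (rot i j c s z * M ω)) (res d (M ω))) μ := by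
    refine integrable_bd μ (obs_meas (EM.res (EM.of_measurable hUmeas) d)
      (EM.res (EM.of_measurable hMmeas) d) i j z) (C := C * C + C * C) ?_
    filter_upwards [hMfull, hUfull] with ω hω hω'
    exact obs_bd hz1 (norm_le_of_le hd hω' hC) (norm_le_of_le hd hω hC)
  have J2 : Integrable (fun ω => obs i j z (res d (M ω)) (res d (M ω))) μ := by
    refine integrable_bd μ (obs_meas (EM.res (EM.of_measurable hMmeas) d)
      (EM.res (EM.of_measurable hMmeas) d) i j z) (C := C * C + C * C) ?_
    filter_upwards [hMfull] with ω hω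
    exact obs_bd hz1 (norm_le_of_le hd hω hC) (norm_le_of_le hd hω hC)
  have E1 := integral_rot μ hMmeas hMrot hU fm
  have E2 := integral_rot μ hMmeas hMrot hU (rho_meas d i)
  have key : ∫ ω, (c * (RCLike.re (z * res d (rot i j c s z * M ω) i j)
        - RCLike.re (z * res d (M ω) i j))
      - s * (rho d (rot i j c s z * M ω) i - rho d (M ω) j)) ∂μ =
      ∫ ω, s * κ * obs i j z (res d (rot i j c s z * M ω)) (res d (M ω)) ∂μ := by
    apply integral_congr_ae
    filter_upwards [hMfull] with ω hω
    exact pt_id hd hω hij hcs hz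
  rw [integral_sub ((isub I1 I2).const_mul c) ((isub I3 I4).const_mul s), integral_const_mul,
    integral_const_mul, integral_const_mul, integral_sub I1 I2, integral_sub I3 I4, E1, E2,
    sub_self, mul_zero, zero_sub] at key
  set x1 := ∫ ω, rho d (M ω) i ∂μ
  set x2 := ∫ ω, rho d (M ω) j ∂μ
  set y1 := ∫ ω, obs i j z (res d (rot i j c s z * M ω)) (res d (M ω)) ∂μ with hy1
  set y2 := ∫ ω, obs i j z (res d (M ω)) (res d (M ω)) ∂μ with hy2
  have k2 : x1 - x2 = - (κ * y1) := by
    apply mul_left_cancel₀ hs0.ne'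
    linarith
  have k3 : |y1 - y2| ≤ s * (2 * C * (4 * C + 4 * |κ| * C ^ 2)) := by
    rw [hy1, hy2, ← integral_sub J1 J2]
    have := norm_integral_le_of_norm_le_const (μ := μ)
      (f := fun ω => obs i j z (res d (rot i j c s z * M ω)) (res d (M ω))
        - obs i j z (res d (M ω)) (res d (M ω)))
      (C := s * (2 * C * (4 * C + 4 * |κ| * C ^ 2))) (by
        filter_upwards [hMfull] with ω hω
        exact pt_bd hd hω hij hcs hz hs0 hc2 hC)
    simpa using this
  rw [k2, show -(κ * y1) + κ * y2 = -(κ * (y1 - y2)) by ring, abs_neg, abs_mul]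
  calc |κ| * |y1 - y2| ≤ |κ| * (s * (2 * C * (4 * C + 4 * |κ| * C ^ 2))) := by gcongr
    _ = _ := by ring

lemma alphaK_nonneg : 0 ≤ alphaK K := by
  unfold alphaK; split_ifs <;> norm_num

lemma alphaK_le : alphaK K ≤ 1 := by
  unfold alphaK; split_ifs <;> norm_num

lemma pair_alpha (hMmeas : Measurable M) (hMfull : ∀ᵐ ω ∂μ, (M ω).rank = ℓ)
    (hMrot : RotationInvariant μ M)
    {d : Fin n → ℝ} (hd : ∀ i, 0 < d i) {i j : Fin n} (hij : i ≠ j) :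
    ∫ ω, (rho d (M ω) i - rho d (M ω) j
      + ((d i)⁻¹ - (d j)⁻¹) * (alphaK K * ‖res d (M ω) i j‖ ^ 2
        + rho d (M ω) i * rho d (M ω) j)) ∂μ = 0 := by
  obtain ⟨C, hC⟩ : ∃ C, ∀ i, d i ≤ C :=
    ⟨∑ i, d i, fun i => Finset.single_le_sum (fun i _ => (hd i).le) (Finset.mem_univ i)⟩
  have J : ∀ z : K, ‖z‖ = 1 →
      Integrable (fun ω => obs i j z (res d (M ω)) (res d (M ω))) μ := by
    intro z hz1
    refine integrable_bd μ (obs_meas (EM.res (EM.of_measurable hMmeas) d)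
      (EM.res (EM.of_measurable hMmeas) d) i j z) (C := C * C + C * C) ?_
    filter_upwards [hMfull] with ω hω
    exact obs_bd hz1 (norm_le_of_le hd hω hC) (norm_le_of_le hd hω hC)
  have I1 := rho_integrable μ hMmeas hMfull hd i
  have I2 := rho_integrable μ hMmeas hMfull hd j
  have one : star (1 : K) * 1 = 1 := by simp
  have p1 := pair_id μ hMmeas hMfull hMrot hd hij one
  by_cases hI : (RCLike.I : K) = 0
  · have ha : alphaK K = 1 := by simp [alphaK, hI]
    have e : ∀ x : K, RCLike.re (1 * 1 * x * x) = ‖x‖ ^ 2 := by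
      intro x
      have hx : ((RCLike.re x : ℝ) : K) = x := by
        have := RCLike.re_add_im x
        rwa [hI, mul_zero, add_zero] at this
      rw [← hx, one_mul, one_mul, ← RCLike.ofReal_mul, RCLike.ofReal_re, RCLike.norm_ofReal,
        sq_abs, sq]
    rw [ha]
    have e2 : ∀ ω, obs i j (1 : K) (res d (M ω)) (res d (M ω)) =
      1 * ‖res d (M ω) i j‖ ^ 2 + rho d (M ω) i * rho d (M ω) j := by
      intro ω
      rw [one_mul, ← e]
      rfl
    simp only [← e2]
    rw [integral_add (isub I1 I2) ((J 1 (by simp)).const_mul _), integral_sub I1 I2,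
      integral_const_mul]
    exact p1
  · have ha : alphaK K = 0 := by simp [alphaK, hI]
    have hII : (RCLike.I : K) * RCLike.I = -1 := RCLike.I_mul_I.resolve_left hI
    have hIs : star (RCLike.I : K) * RCLike.I = 1 := by
      rw [RCLike.star_def, RCLike.conj_I]
      linear_combination -hII
    have p2 := pair_id μ hMmeas hMfull hMrot hd hij hIs
    have e2 : ∀ ω, (1 / 2) * (obs i j (1 : K) (res d (M ω)) (res d (M ω)) +
        obs i j (RCLike.I : K) (res d (M ω)) (res d (M ω))) =
      0 * ‖res d (M ω) i j‖ ^ 2 + rho d (M ω) i * rho d (M ω) j := by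
      intro ω
      unfold obs rho
      rw [hII]
      simp only [one_mul, neg_mul, map_neg]
      ring
    rw [ha]
    simp only [← e2]
    rw [integral_add (isub I1 I2) (((iadd (J 1 (by simp)) (J _ (norm_of_unit hIs))).const_mul _).const_mul _),
      integral_sub I1 I2, integral_const_mul, integral_const_mul,
      integral_add (J 1 (by simp)) (J _ (norm_of_unit hIs))]
    linarith

end Pair

/-- the purely real-analytic limit argument -/
lemma limit_arg {φ ψ ε : ℝ → ℝ} {b β γ c0 q : ℝ} (hβ : 0 < β) (hq : 0 ≤ q)
    (hφψ : ∀ a, b ≤ a → β * φ a = γ - ε a)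
    (hε0 : ∀ a, b ≤ a → 0 ≤ ε a)
    (hε : ∀ a, b ≤ a → ε a ≤ (c0 * φ a + 2 * ψ a) / a)
    (hb : 0 < b)
    (hmono : ∀ a' a, b ≤ a' → a' ≤ a → φ a' ≤ φ a)
    (hψ : ∀ a' a, b ≤ a' → a' ≤ a → ψ a ≤ q * a' * φ a + q * a * (φ a - φ a')) :
    Tendsto φ atTop (𝓝 (γ / β)) := by
  have hup : ∀ a, b ≤ a → φ a ≤ γ / β := by
    intro a ha
    rw [le_div_iff₀ hβ]
    have := hφψ a ha
    have := hε0 a ha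
    linarith
  have hm : Monotone fun a => φ (max b a) := fun x y hxy =>
    hmono _ _ (le_max_left _ _) (max_le_max le_rfl hxy)
  have hbd : BddAbove (Set.range fun a => φ (max b a)) := by
    refine ⟨γ / β, ?_⟩
    rintro _ ⟨a, rfl⟩
    exact hup _ (le_max_left _ _)
  obtain ⟨τ, hτ0⟩ : ∃ τ, Tendsto (fun a => φ (max b a)) atTop (𝓝 τ) :=
    ⟨_, tendsto_atTop_ciSup hm hbd⟩
  have hτ : Tendsto φ atTop (𝓝 τ) := by
    refine hτ0.congr' ?_
    filter_upwards [eventually_ge_atTop b] with a ha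
    rw [max_eq_right ha]
  have hεlim : Tendsto ε atTop (𝓝 (γ - β * τ)) := by
    refine ((tendsto_const_nhds (x := γ)).sub (hτ.const_mul β)).congr' ?_
    filter_upwards [eventually_ge_atTop b] with a ha
    have := hφψ a ha
    linarith
  have h0 : 0 ≤ γ - β * τ := by
    refine ge_of_tendsto hεlim ?_
    filter_upwards [eventually_ge_atTop b] with a ha
    exact hε0 a ha
  have h1 : ∀ a', b ≤ a' → γ - β * τ ≤ 2 * q * (τ - φ a') := by
    intro a' ha'
    have hl : Tendsto (fun a => (c0 + 2 * q * a') * φ a * a⁻¹ + 2 * q * (φ a - φ a')) atTop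
        (𝓝 ((c0 + 2 * q * a') * τ * 0 + 2 * q * (τ - φ a'))) :=
      ((hτ.const_mul _).mul tendsto_inv_atTop_zero).add ((hτ.sub_const _).const_mul _)
    rw [mul_zero, zero_add] at hl
    refine le_of_tendsto_of_tendsto hεlim hl ?_
    filter_upwards [eventually_ge_atTop a'] with a ha
    have hapos : 0 < a := by linarith
    refine (hε a (ha'.trans ha)).trans ?_
    rw [div_le_iff₀ hapos]
    have := hψ a' a ha' ha
    have e : ((c0 + 2 * q * a') * φ a * a⁻¹ + 2 * q * (φ a - φ a')) * a
      = (c0 + 2 * q * a') * φ a + 2 * q * (φ a - φ a') * a := by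
      field_simp
    rw [e]
    linarith
  have h2 : γ - β * τ ≤ 0 := by
    have hl : Tendsto (fun a => 2 * q * (τ - φ a)) atTop (𝓝 (2 * q * (τ - τ))) :=
      (hτ.const_sub _).const_mul _
    rw [sub_self, mul_zero] at hl
    refine ge_of_tendsto hl ?_
    filter_upwards [eventually_ge_atTop b] with a ha
    exact h1 a ha
  have : τ = γ / β := by
    rw [eq_div_iff hβ.ne']
    linarith
  rw [← this]
  exact hτ

section Main

/-- diagonal of `H_{a,b}` in the full rank case -/
def dd (n q : ℕ) (a b : ℝ) (i : Fin n) : ℝ := if (i : ℕ) < q then a else b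

/-- first block -/
def B1 (n q : ℕ) : Finset (Fin n) := Finset.univ.filter fun i => (i : ℕ) < q
/-- second block -/
def B2 (n q : ℕ) : Finset (Fin n) := Finset.univ.filter fun i => ¬ (i : ℕ) < q

lemma sum_split (n q : ℕ) (f : Fin n → ℝ) : ∑ i, f i = ∑ i ∈ B1 n q, f i + ∑ i ∈ B2 n q, f i :=
  (Finset.sum_filter_add_sum_filter_not _ _ _).symm

lemma card_B1 {n q : ℕ} (h : q ≤ n) : (B1 n q).card = q := by
  unfold B1
  rw [Fin.card_filter_val_lt]
  exact min_eq_right h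

lemma card_B2 {n q : ℕ} (h : q ≤ n) : ((B2 n q).card : ℝ) = (n : ℝ) - q := by
  have h1 := Finset.card_filter_add_card_filter_not (s := (Finset.univ : Finset (Fin n)))
    (fun i : Fin n => (i : ℕ) < q)
  have h2 := card_B1 h
  unfold B1 at h2
  unfold B2
  rw [h2, Finset.card_univ, Fintype.card_fin] at h1
  rw [eq_sub_iff_add_eq]
  exact_mod_cast (by omega : _ + q = n)

lemma dd_pos {n q : ℕ} {a b : ℝ} (ha : 0 < a) (hb : 0 < b) (i : Fin n) : 0 < dd n q a b i := by
  unfold dd; split_ifs <;> assumption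

lemma dd_B1 {n q : ℕ} {a b : ℝ} {i : Fin n} (h : i ∈ B1 n q) : dd n q a b i = a := by
  unfold dd; rw [if_pos]; simpa [B1] using h

lemma dd_B2 {n q : ℕ} {a b : ℝ} {i : Fin n} (h : i ∈ B2 n q) : dd n q a b i = b := by
  unfold dd; rw [if_neg]; simpa [B2] using h

variable {K : Type*} [RCLike K] {n ℓ : ℕ}

/-- trace of the first block of the residual -/
def tB (q : ℕ) (a b : ℝ) (A : Matrix (Fin n) (Fin ℓ) K) : ℝ :=
  ∑ i ∈ B1 n q, rho (dd n q a b) A i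

/-- trace of the second block of the residual -/
def uB (q : ℕ) (a b : ℝ) (A : Matrix (Fin n) (Fin ℓ) K) : ℝ :=
  ∑ i ∈ B2 n q, rho (dd n q a b) A i

/-- The summed Stein identity integrand -/
def zB (q : ℕ) (a b : ℝ) (A : Matrix (Fin n) (Fin ℓ) K) : ℝ :=
  ∑ i ∈ B1 n q, ∑ j ∈ B2 n q, (rho (dd n q a b) A i - rho (dd n q a b) A j
      + ((dd n q a b i)⁻¹ - (dd n q a b j)⁻¹) * (alphaK K * ‖res (dd n q a b) A i j‖ ^ 2
        + rho (dd n q a b) A i * rho (dd n q a b) A j))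

section pt

variable {q : ℕ} {a b : ℝ} {A : Matrix (Fin n) (Fin ℓ) K}

lemma tB_nonneg (ha : 0 < a) (hb : 0 < b) (hA : A.rank = ℓ) : 0 ≤ tB q a b A :=
  Finset.sum_nonneg fun i _ => rho_nonneg (dd_pos ha hb) hA i

lemma tB_le (hqn : q ≤ n) (ha : 0 < a) (hb : 0 < b) (hA : A.rank = ℓ) : tB q a b A ≤ q * a := by
  have : tB q a b A ≤ ∑ i ∈ B1 n q, a := Finset.sum_le_sum fun i hi =>
    (rho_le (dd_pos ha hb) hA i).trans (dd_B1 hi).le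
  rwa [Finset.sum_const, card_B1 hqn, nsmul_eq_mul] at this

lemma tB_mono {a' : ℝ} (ha' : 0 < a') (haa : a' ≤ a) (hb : 0 < b) (hA : A.rank = ℓ) :
    tB q a' b A ≤ tB q a b A :=
  Finset.sum_le_sum fun i _ => rho_mono (dd_pos ha' hb) (fun i => by
    unfold dd; split_ifs; exacts [haa, le_rfl]) hA i

lemma uB_eq (ha : 0 < a) (hb : 0 < b) (hA : A.rank = ℓ) :
    uB q a b A = b * ((n : ℝ) - ℓ) - b / a * tB q a b A := by
  have h := trace_sum (dd_pos (q := q) ha hb) hA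
  rw [sum_split n q, Finset.sum_congr rfl (fun i hi => by rw [dd_B1 hi]),
    Finset.sum_congr (s₁ := B2 n q) rfl (fun i hi => by rw [dd_B2 hi]), ← Finset.mul_sum,
    ← Finset.mul_sum] at h
  change a⁻¹ * tB q a b A + b⁻¹ * uB q a b A = _ at h
  rw [← h]
  field_simp
  ring

lemma zB_bounds (hqn : q ≤ n) (hℓn : ℓ ≤ n) (hb : 0 < b) (hab : b ≤ a) (hA : A.rank = ℓ) :
    0 ≤ zB q a b A - ((ℓ : ℝ) - q - alphaK K) * tB q a b A + q * b * ((n : ℝ) - ℓ) ∧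
    zB q a b A - ((ℓ : ℝ) - q - alphaK K) * tB q a b A + q * b * ((n : ℝ) - ℓ) ≤
      ((q * b + b * (1 + ((n : ℝ) - ℓ))) * tB q a b A + 2 * tB q a b A ^ 2) / a := by
  have ha : 0 < a := hb.trans_le hab
  have hd := dd_pos (n := n) (q := q) ha hb
  have hα0 := alphaK_nonneg (K := K)
  have hα1 := alphaK_le (K := K)
  set α := alphaK K
  set R := res (dd n q a b) A with hR
  set w := ∑ i ∈ B1 n q, ∑ j ∈ B2 n q, ‖R i j‖ ^ 2 with hw
  set S := ∑ i ∈ B1 n q, ∑ j ∈ B1 n q, ‖R i j‖ ^ 2 with hS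
  set t := tB q a b A with ht
  have hu := uB_eq (q := q) ha hb hA
  have ht0 : 0 ≤ t := tB_nonneg ha hb hA
  have hS0 : 0 ≤ S := Finset.sum_nonneg fun i _ => Finset.sum_nonneg fun j _ => by positivity
  have hS1 : S ≤ t ^ 2 := by
    rw [sq, ht, tB, Finset.sum_mul_sum]
    exact Finset.sum_le_sum fun i _ => Finset.sum_le_sum fun j _ => norm_sq_le_rho hd hA i j
  have htw : t = a⁻¹ * S + b⁻¹ * w := by
    rw [ht, tB, hS, hw, Finset.mul_sum, Finset.mul_sum, ← Finset.sum_add_distrib]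
    refine Finset.sum_congr rfl fun i _ => ?_
    rw [rho_sum hd hA i, sum_split n q, Finset.mul_sum, Finset.mul_sum]
    congr 1
    · exact Finset.sum_congr rfl fun j hj => by rw [dd_B1 hj]
    · exact Finset.sum_congr rfl fun j hj => by rw [dd_B2 hj]
  have hw2 : w = b * t - b / a * S := by
    rw [htw]; field_simp; ring
  have hz : zB q a b A = ((n : ℝ) - q) * t - q * uB q a b A
      + (a⁻¹ - b⁻¹) * (α * w + t * uB q a b A) := by
    have e1 : zB q a b A = ∑ i ∈ B1 n q, ∑ j ∈ B2 n q, (rho (dd n q a b) A i - rho (dd n q a b) A j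
      + (a⁻¹ - b⁻¹) * (α * ‖R i j‖ ^ 2 + rho (dd n q a b) A i * rho (dd n q a b) A j)) := by
      refine Finset.sum_congr rfl fun i hi => Finset.sum_congr rfl fun j hj => ?_
      rw [dd_B1 hi, dd_B2 hj]
    rw [e1]
    simp only [Finset.sum_add_distrib, Finset.sum_sub_distrib, ← Finset.mul_sum, Finset.sum_const,
      nsmul_eq_mul, card_B2 hqn, card_B1 hqn, ← Finset.sum_mul]
    rfl
  have hk : 0 ≤ (n : ℝ) - ℓ := by
    rw [sub_nonneg]; exact_mod_cast hℓn
  set k := (n : ℝ) - ℓ with hkdef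
  have hq0 : (0 : ℝ) ≤ q := Nat.cast_nonneg q
  have hmain : zB q a b A - ((ℓ : ℝ) - q - α) * t + q * b * k
      = (q * b * t + b * (α + k) * t + (1 - b / a) * (α * S + t ^ 2)) / a := by
    rw [hz, hu, hw2]
    have : (ℓ : ℝ) = n - k := by rw [hkdef]; ring
    rw [this]
    field_simp
    ring
  have hba : 0 ≤ 1 - b / a := by
    rw [sub_nonneg, div_le_one ha]; exact hab
  have hba1 : 1 - b / a ≤ 1 := by
    have : 0 ≤ b / a := by positivity
    linarith
  rw [hmain]
  constructor
  · positivity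
  · refine div_le_div_of_nonneg_right ?_ ha.le
    have h1 : (1 - b / a) * (α * S + t ^ 2) ≤ 1 * (1 * t ^ 2 + t ^ 2) := by
      gcongr
    have h2 : b * (α + k) * t ≤ b * (1 + k) * t := by gcongr
    linarith

end pt

variable [MeasurableSpace K] [BorelSpace K]
  {Y : Type*} [MeasurableSpace Y] (μ : Measure Y) [IsProbabilityMeasure μ]
    {M : Y → Matrix (Fin n) (Fin ℓ) K}

lemma tB_integrable (hMmeas : Measurable M) (hMfull : ∀ᵐ ω ∂μ, (M ω).rank = ℓ) (q : ℕ)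
    {a b : ℝ} (ha : 0 < a) (hb : 0 < b) : Integrable (fun ω => tB q a b (M ω)) μ :=
  integrable_finset_sum _ fun i _ => rho_integrable μ hMmeas hMfull (dd_pos ha hb) i

lemma tB_sq_integrable (hMmeas : Measurable M) (hMfull : ∀ᵐ ω ∂μ, (M ω).rank = ℓ) {q : ℕ}
    (hqn : q ≤ n)
    {a b : ℝ} (ha : 0 < a) (hb : 0 < b) : Integrable (fun ω => tB q a b (M ω) ^ 2) μ := by
  have hm : Measurable fun ω => tB q a b (M ω) :=
    Finset.measurable_sum _ fun i _ => (rho_meas _ i).comp hMmeas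
  refine integrable_bd μ (hm.pow_const 2) (C := (q * a) ^ 2) ?_
  filter_upwards [hMfull] with ω hω
  rw [abs_of_nonneg (sq_nonneg _)]
  have := tB_nonneg (q := q) ha hb hω
  have := tB_le hqn ha hb hω
  gcongr

lemma zB_int (hMmeas : Measurable M) (hMfull : ∀ᵐ ω ∂μ, (M ω).rank = ℓ)
    (hMrot : RotationInvariant μ M) (q : ℕ) {a b : ℝ} (ha : 0 < a) (hb : 0 < b) :
    Integrable (fun ω => zB q a b (M ω)) μ ∧ ∫ ω, zB q a b (M ω) ∂μ = 0 := by
  have hd := dd_pos (n := n) (q := q) ha hb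
  obtain ⟨C, hC⟩ : ∃ C, ∀ i, dd n q a b i ≤ C :=
    ⟨∑ i, dd n q a b i, fun i => Finset.single_le_sum (fun i _ => (hd i).le) (Finset.mem_univ i)⟩
  have hI : ∀ i j, Integrable (fun ω => (rho (dd n q a b) (M ω) i - rho (dd n q a b) (M ω) j
      + ((dd n q a b i)⁻¹ - (dd n q a b j)⁻¹) * (alphaK K * ‖res (dd n q a b) (M ω) i j‖ ^ 2
        + rho (dd n q a b) (M ω) i * rho (dd n q a b) (M ω) j))) μ := by
    intro i j
    refine iadd (isub (rho_integrable μ hMmeas hMfull hd i) (rho_integrable μ hMmeas hMfull hd j))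
      (Integrable.const_mul (iadd (Integrable.const_mul ?_ _) ?_) _)
    · refine integrable_bd μ (((res_meas (dd n q a b) i j).comp hMmeas).norm.pow_const 2)
        (C := C ^ 2) ?_
      filter_upwards [hMfull] with ω hω
      rw [abs_of_nonneg (sq_nonneg _)]
      have := norm_le_of_le hd hω hC i j
      gcongr
    · refine integrable_bd μ (((rho_meas (dd n q a b) i).comp hMmeas).mul
        ((rho_meas (dd n q a b) j).comp hMmeas)) (C := C * C) ?_
      filter_upwards [hMfull] with ω hω
      have h1 := rho_nonneg hd hω i
      have h2 := rho_nonneg hd hω j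
      have h3 := (rho_le hd hω i).trans (hC i)
      have h4 := (rho_le hd hω j).trans (hC j)
      change |rho (dd n q a b) (M ω) i * rho (dd n q a b) (M ω) j| ≤ _
      rw [abs_of_nonneg (mul_nonneg h1 h2)]
      exact mul_le_mul h3 h4 h2 (h1.trans h3)
  constructor
  · exact integrable_finset_sum _ fun i _ => integrable_finset_sum _ fun j _ => hI i j
  · unfold zB
    rw [integral_finset_sum _ fun i _ => integrable_finset_sum _ fun j _ => hI i j]
    refine Finset.sum_eq_zero fun i hi => ?_
    rw [integral_finset_sum _ fun j _ => hI i j]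
    refine Finset.sum_eq_zero fun j hj => ?_
    refine pair_alpha μ hMmeas hMfull hMrot hd ?_
    rintro rfl
    simp only [B1, B2, Finset.mem_filter, Finset.mem_univ, true_and] at hi hj
    exact hj hi

lemma tB_tendsto (hMmeas : Measurable M) (hMfull : ∀ᵐ ω ∂μ, (M ω).rank = ℓ)
    (hMrot : RotationInvariant μ M) {q : ℕ} (hqn : q ≤ n) (hℓn : ℓ ≤ n) {b : ℝ} (hb : 0 < b)
    (hq : (q : ℝ) + alphaK K < (ℓ : ℝ)) :
    Tendsto (fun a => ∫ ω, tB q a b (M ω) ∂μ) atTop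
      (𝓝 (q * b * ((n : ℝ) - ℓ) / ((ℓ : ℝ) - q - alphaK K))) := by
  have hI := fun a (ha : b ≤ a) => tB_integrable μ hMmeas hMfull q (hb.trans_le ha) hb
  have hI2 := fun a (ha : b ≤ a) => tB_sq_integrable μ hMmeas hMfull hqn (hb.trans_le ha) hb
  have hε : ∀ a, b ≤ a → q * b * ((n : ℝ) - ℓ)
        - ((ℓ : ℝ) - q - alphaK K) * ∫ ω, tB q a b (M ω) ∂μ
      = ∫ ω, (zB q a b (M ω) - ((ℓ : ℝ) - q - alphaK K) * tB q a b (M ω)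
        + q * b * ((n : ℝ) - ℓ)) ∂μ := by
    intro a ha
    obtain ⟨h1, h2⟩ := zB_int μ hMmeas hMfull hMrot q (hb.trans_le ha) hb
    rw [integral_add (isub h1 ((hI a ha).const_mul _)) (integrable_const _),
      integral_sub h1 ((hI a ha).const_mul _), h2, integral_const_mul, integral_const]
    simp
    ring
  refine limit_arg (ψ := fun a => ∫ ω, tB q a b (M ω) ^ 2 ∂μ)
    (ε := fun a => q * b * ((n : ℝ) - ℓ) - ((ℓ : ℝ) - q - alphaK K) * ∫ ω, tB q a b (M ω) ∂μ)
    (b := b) (c0 := q * b + b * (1 + ((n : ℝ) - ℓ))) (q := q)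
    (by linarith) (Nat.cast_nonneg q) (fun a _ => by ring) ?_ ?_ hb ?_ ?_
  · intro a ha
    rw [hε a ha]
    refine integral_nonneg_of_ae ?_
    filter_upwards [hMfull] with ω hω
    exact (zB_bounds hqn hℓn hb ha hω).1
  · intro a ha
    obtain ⟨h1, h2⟩ := zB_int μ hMmeas hMfull hMrot q (hb.trans_le ha) hb
    rw [hε a ha, ← integral_const_mul, ← integral_const_mul,
      ← integral_add ((hI a ha).const_mul _) ((hI2 a ha).const_mul _), ← integral_div]
    refine integral_mono_ae (iadd (isub h1 ((hI a ha).const_mul _)) (integrable_const _))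
      ((iadd ((hI a ha).const_mul _) ((hI2 a ha).const_mul _)).div_const _) ?_
    filter_upwards [hMfull] with ω hω
    exact (zB_bounds hqn hℓn hb ha hω).2
  · intro a' a ha' ha
    refine integral_mono_ae (hI a' ha') (hI a (ha'.trans ha)) ?_
    filter_upwards [hMfull] with ω hω
    exact tB_mono (hb.trans_le ha') ha hb hω
  · intro a' a ha' ha
    have i1 := hI a (ha'.trans ha)
    have i2 := hI a' ha'
    rw [← integral_sub i1 i2, ← integral_const_mul, ← integral_const_mul,
      ← integral_add (i1.const_mul _) ((isub i1 i2).const_mul _)]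
    refine integral_mono_ae (hI2 a (ha'.trans ha)) (iadd (i1.const_mul _)
      ((isub i1 i2).const_mul _)) ?_
    filter_upwards [hMfull] with ω hω
    have a0 := hb.trans_le ha'
    have a1 := a0.trans_le ha
    have t0 := tB_nonneg (q := q) a1 hb hω
    have t1 := tB_mono (q := q) a0 ha hb hω
    have t2 := tB_le hqn a0 hb hω
    have t3 := tB_le hqn a1 hb hω
    have s1 := mul_le_mul_of_nonneg_right t2 t0
    have s2 := mul_le_mul_of_nonneg_right t3 (sub_nonneg.mpr t1)
    linarith

lemma base_case (hMmeas : Measurable M) (hMfull : ∀ᵐ ω ∂μ, (M ω).rank = ℓ)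
    (hMrot : RotationInvariant μ M) {q : ℕ} (hqn : q ≤ n) (hℓn : ℓ ≤ n) {b : ℝ} (hb : 0 < b)
    (hq : (q : ℝ) + alphaK K < (ℓ : ℝ))
    (pinv : (m n : ℕ) → Matrix (Fin m) (Fin n) K → Matrix (Fin n) (Fin m) K)
    (hpinv : ∀ (m n : ℕ) (A : Matrix (Fin m) (Fin n) K), IsMoorePenrose A (pinv m n A)) :
    Filter.Tendsto
      (fun a : ℝ => ∫ ω, RCLike.re (Matrix.trace
        (twoEigMatrix K n q n a b -
          twoEigMatrix K n q n a b * M ω *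
            (pinv ℓ ℓ ((M ω)ᴴ * twoEigMatrix K n q n a b * M ω) *
              ((M ω)ᴴ * twoEigMatrix K n q n a b)))) ∂μ)
      Filter.atTop
      (nhds (b * ((n : ℝ) - (ℓ : ℝ)) *
        (1 + (q : ℝ) / ((ℓ : ℝ) - (q : ℝ) - alphaK K)))) := by
  have hH : ∀ a, twoEigMatrix K n q n a b = dg K (dd n q a b) := by
    intro a
    unfold twoEigMatrix dg dd
    congr 1
    ext i
    simp only [i.2, if_true]
    split_ifs <;> rfl
  have hp : ∀ G : Matrix (Fin ℓ) (Fin ℓ) K, IsUnit G.det → pinv ℓ ℓ G = G⁻¹ := by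
    intro G hG
    obtain ⟨h, -⟩ := hpinv ℓ ℓ G
    have h1 : G * pinv ℓ ℓ G = 1 := by
      have := congrArg (· * G⁻¹) h
      simpa [Matrix.mul_assoc, Matrix.mul_nonsing_inv _ hG] using this
    exact (Matrix.inv_eq_right_inv h1).symm
  have e : (fun a : ℝ => b * ((n : ℝ) - ℓ) + (1 - b * a⁻¹) * ∫ ω, tB q a b (M ω) ∂μ)
      =ᶠ[atTop] (fun a : ℝ => ∫ ω, RCLike.re (Matrix.trace
        (twoEigMatrix K n q n a b -
          twoEigMatrix K n q n a b * M ω *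
            (pinv ℓ ℓ ((M ω)ᴴ * twoEigMatrix K n q n a b * M ω) *
              ((M ω)ᴴ * twoEigMatrix K n q n a b)))) ∂μ) := by
    filter_upwards [eventually_ge_atTop b] with a ha
    have ha0 := hb.trans_le ha
    have hI := tB_integrable μ hMmeas hMfull q ha0 hb
    have : ∫ ω, (b * ((n : ℝ) - ℓ) + (1 - b * a⁻¹) * tB q a b (M ω)) ∂μ
      = b * ((n : ℝ) - ℓ) + (1 - b * a⁻¹) * ∫ ω, tB q a b (M ω) ∂μ := by
      rw [integral_add (integrable_const _) (hI.const_mul _), integral_const, integral_const_mul]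
      simp
    rw [← this]
    apply integral_congr_ae
    filter_upwards [hMfull] with ω hω
    rw [hH, hp _ (gram_isUnit (dd_pos ha0 hb) hω)]
    change _ = RCLike.re (Matrix.trace (res (dd n q a b) (M ω)))
    have e1 : RCLike.re (Matrix.trace (res (dd n q a b) (M ω))) = ∑ i, rho (dd n q a b) (M ω) i := by
      unfold Matrix.trace
      rw [map_sum]
      rfl
    rw [e1, sum_split n q]
    change _ = tB q a b (M ω) + uB q a b (M ω)
    rw [uB_eq ha0 hb hω]
    ring
  refine Tendsto.congr' e ?_
  have h1 := tB_tendsto μ hMmeas hMfull hMrot hqn hℓn hb hq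
  have h2 : Tendsto (fun a : ℝ => 1 - b * a⁻¹) atTop (𝓝 (1 - b * 0)) :=
    (tendsto_inv_atTop_zero.const_mul b).const_sub 1
  have h3 := (h2.mul h1).const_add (b * ((n : ℝ) - ℓ))
  convert h3 using 2
  ring

end Main

section Drop

variable {K : Type*} [RCLike K] {m ℓ : ℕ}

/-- drop the last row -/
def dropRow (A : Matrix (Fin (m + 1)) (Fin ℓ) K) : Matrix (Fin m) (Fin ℓ) K :=
  fun i j => A i.castSucc j

/-- extend a matrix by a trailing one -/
def extU (U : Matrix (Fin m) (Fin m) K) : Matrix (Fin (m + 1)) (Fin (m + 1)) K :=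
  fun i j => Fin.lastCases (motive := fun _ => K) (if j = Fin.last m then 1 else 0)
    (fun i' => Fin.lastCases (motive := fun _ => K) 0 (fun j' => U i' j') j) i

lemma extU_cc (U : Matrix (Fin m) (Fin m) K) (i j : Fin m) :
    extU U i.castSucc j.castSucc = U i j := by simp [extU]

lemma extU_cl (U : Matrix (Fin m) (Fin m) K) (i : Fin m) :
    extU U i.castSucc (Fin.last m) = 0 := by simp [extU]

lemma extU_lc (U : Matrix (Fin m) (Fin m) K) (j : Fin m) :
    extU U (Fin.last m) j.castSucc = 0 := by simp [extU, (Fin.castSucc_lt_last j).ne]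

lemma extU_ll (U : Matrix (Fin m) (Fin m) K) :
    extU U (Fin.last m) (Fin.last m) = 1 := by simp [extU]

lemma extU_mem {U : Matrix (Fin m) (Fin m) K} (hU : U ∈ Matrix.unitaryGroup (Fin m) K) :
    extU U ∈ Matrix.unitaryGroup (Fin (m + 1)) K := by
  rw [Matrix.mem_unitaryGroup_iff] at hU ⊢
  ext i j
  rw [Matrix.mul_apply, Fin.sum_univ_castSucc]
  simp only [Matrix.star_apply]
  induction i using Fin.lastCases with
  | last =>
    induction j using Fin.lastCases with
    | last => simp [extU_lc, extU_ll]
    | cast j => simp [extU_lc, extU_cl, (Fin.castSucc_lt_last j).ne']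
  | cast i =>
    induction j using Fin.lastCases with
    | last => simp [extU_lc, extU_cl, (Fin.castSucc_lt_last i).ne]
    | cast j =>
      have h := congrFun (congrFun hU i) j
      rw [Matrix.mul_apply] at h
      simp only [Matrix.star_apply] at h
      simp only [extU_cc, extU_cl, zero_mul, add_zero, h, Matrix.one_apply, Fin.castSucc_inj]

lemma dropRow_extU (U : Matrix (Fin m) (Fin m) K) (A : Matrix (Fin (m + 1)) (Fin ℓ) K) :
    dropRow (extU U * A) = U * dropRow A := by
  ext i j
  change (extU U * A) i.castSucc j = _
  rw [Matrix.mul_apply, Fin.sum_univ_castSucc, Matrix.mul_apply]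
  simp only [extU_cc, extU_cl, zero_mul, add_zero]
  rfl

lemma dropRow_mulVec (A : Matrix (Fin (m + 1)) (Fin ℓ) K) (x : Fin ℓ → K) (i : Fin m) :
    (dropRow A *ᵥ x) i = (A *ᵥ x) i.castSucc := rfl

/-- a unitary matrix whose last row is a prescribed direction -/
lemma exists_unitary (v : Fin (m + 1) → K) (hv : v ≠ 0) :
    ∃ U ∈ Matrix.unitaryGroup (Fin (m + 1)) K, ∃ k : K, k ≠ 0 ∧
      ∀ j, star (U (Fin.last m) j) = k * v j := by
  have hw : (WithLp.toLp 2 v : EuclideanSpace K (Fin (m + 1))) ≠ 0 := by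
    intro h
    apply hv
    ext j
    simpa using congrArg (fun z : EuclideanSpace K (Fin (m + 1)) => z j) h
  set w : EuclideanSpace K (Fin (m + 1)) := WithLp.toLp 2 v with hwdef
  have hn : ‖w‖ ≠ 0 := norm_ne_zero_iff.mpr hw
  set k : K := ((‖w‖⁻¹ : ℝ) : K) with hk
  have hk0 : k ≠ 0 := by
    rw [hk]; exact_mod_cast inv_ne_zero hn
  have ho : Orthonormal K (({Fin.last m} : Set (Fin (m + 1))).domRestrict
      (fun _ : Fin (m + 1) => k • w)) := by
    constructor
    · intro i
      change ‖k • w‖ = 1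
      rw [norm_smul, hk, RCLike.norm_ofReal, abs_inv, abs_norm]
      exact inv_mul_cancel₀ hn
    · intro i j hij
      exact absurd (Subsingleton.elim i j) hij
  obtain ⟨b, hb⟩ := Orthonormal.exists_orthonormalBasis_extension_of_card_eq
    (by simp) ho
  refine ⟨Matrix.of fun i j => star (b i j), ?_, k, hk0, ?_⟩
  · rw [Matrix.mem_unitaryGroup_iff]
    ext i j
    rw [Matrix.mul_apply]
    simp only [Matrix.star_apply, Matrix.of_apply, star_star]
    have := orthonormal_iff_ite.mp b.orthonormal i j
    rw [PiLp.inner_apply] at this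
    rw [Matrix.one_apply, ← this]
    refine Finset.sum_congr rfl fun x _ => ?_
    simp [mul_comm]
  · intro j
    rw [Matrix.of_apply, star_star, hb (Fin.last m) rfl]
    simp [hwdef]

/-- if `U A` loses rank on dropping the last row then the direction lies in the range of `A` -/
lemma bad_imp {A : Matrix (Fin (m + 1)) (Fin ℓ) K} (hA : A.rank = ℓ)
    {U : Matrix (Fin (m + 1)) (Fin (m + 1)) K} (hU : U ∈ Matrix.unitaryGroup (Fin (m + 1)) K)
    {v : Fin (m + 1) → K} {k : K} (hk : k ≠ 0)
    (hUv : ∀ j, star (U (Fin.last m) j) = k * v j)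
    (hbad : ((dropRow (U * A))ᴴ * dropRow (U * A)).det = 0)
    {y : Fin (m + 1) → K} (hy : y ᵥ* A = 0) : y ⬝ᵥ v = 0 := by
  obtain ⟨x, hx0, hx⟩ := Matrix.exists_mulVec_eq_zero_iff.mpr hbad
  have hx1 : dropRow (U * A) *ᵥ x = 0 := by
    have : (star (dropRow (U * A) *ᵥ x)) ⬝ᵥ (dropRow (U * A) *ᵥ x) = 0 := by
      rw [Matrix.star_mulVec, ← Matrix.dotProduct_mulVec, Matrix.mulVec_mulVec, hx]
      simp
    exact dotProduct_star_self_eq_zero.mp this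
  have hz : ∀ i : Fin m, (U *ᵥ (A *ᵥ x)) i.castSucc = 0 := by
    intro i
    rw [Matrix.mulVec_mulVec, ← dropRow_mulVec, hx1]
    rfl
  have hAx : A *ᵥ x ≠ 0 := by
    intro h
    apply hx0
    apply mulVec_inj_of_rank hA
    rw [h, Matrix.mulVec_zero]
  set c := (U *ᵥ (A *ᵥ x)) (Fin.last m) with hc
  have e : A *ᵥ x = (c * k) • v := by
    have h1 : A *ᵥ x = star U *ᵥ (U *ᵥ (A *ᵥ x)) := by
      rw [Matrix.mulVec_mulVec (M := star U), Matrix.mem_unitaryGroup_iff'.mp hU, Matrix.one_mulVec]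
    rw [h1]
    ext j
    rw [Matrix.mulVec, dotProduct, Fin.sum_univ_castSucc]
    simp only [hz, mul_zero, Finset.sum_const_zero, zero_add, Matrix.star_apply, hUv, ← hc,
      Pi.smul_apply, smul_eq_mul]
    ring
  have hck : c * k ≠ 0 := by
    intro h
    apply hAx
    rw [e, h, zero_smul]
  have h2 : y ⬝ᵥ (A *ᵥ x) = 0 := by
    rw [Matrix.dotProduct_mulVec, hy, zero_dotProduct]
  rw [e, dotProduct_smul, smul_eq_mul] at h2
  exact (mul_eq_zero.mp h2).resolve_left hck

lemma exists_left_null (A : Matrix (Fin (m + 1)) (Fin ℓ) K) (h : ℓ ≤ m) :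
    ∃ y : Fin (m + 1) → K, y ≠ 0 ∧ y ᵥ* A = 0 := by
  have := LinearMap.ker_ne_bot_of_finrank_lt (f := Matrix.vecMulLinear A) (by simp; omega)
  obtain ⟨y, hy, hy0⟩ := (Submodule.ne_bot_iff _).mp this
  exact ⟨y, hy0, by simpa using hy⟩

lemma card_bad {y : Fin (m + 1) → K} (hy : y ≠ 0) (S : Finset ℕ)
    (hS : ∀ t ∈ S, y ⬝ᵥ (fun i : Fin (m + 1) => (t : K) ^ (i : ℕ)) = 0) : S.card ≤ m := by
  by_contra hlt
  push Not at hlt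
  obtain ⟨T, hTS, hT⟩ := Finset.exists_subset_card_eq (Nat.succ_le_of_lt hlt)
  let f : Fin (m + 1) ↪o ℕ := T.orderEmbOfFin hT
  apply hy
  apply Matrix.eq_zero_of_forall_index_sum_mul_pow_eq_zero (f := fun j => ((f j : ℕ) : K))
  · intro a b hab
    exact f.injective (Nat.cast_injective (R := K) hab)
  · intro j
    have := hS (f j) (hTS (Finset.orderEmbOfFin_mem _ _ _))
    simpa [dotProduct] using this

end Drop

section DropMeas

variable {K : Type*} [RCLike K] [MeasurableSpace K] [BorelSpace K]
  {Y : Type*} [MeasurableSpace Y] {m ℓ : ℕ}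

lemma dropRow_meas : Measurable (dropRow : Matrix (Fin (m + 1)) (Fin ℓ) K → _) :=
  EM.measurable fun i j => EM.of_measurable measurable_id i.castSucc j

lemma dropRow_rot (μ : Measure Y) {M : Y → Matrix (Fin (m + 1)) (Fin ℓ) K} (hM : Measurable M)
    (hMrot : RotationInvariant μ M) : RotationInvariant μ fun ω => dropRow (M ω) := by
  intro U hU
  have h := hMrot (extU U) (extU_mem hU)
  have hUM : Measurable fun ω => extU U * M ω :=
    ((EM.const (extU U)).mul (EM.of_measurable hM)).measurable
  have h2 := congrArg (Measure.map dropRow) h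
  rw [Measure.map_map dropRow_meas hUM, Measure.map_map dropRow_meas hM] at h2
  rw [show (fun ω => U * dropRow (M ω)) = dropRow ∘ fun ω => extU U * M ω from
    funext fun ω => (dropRow_extU U (M ω)).symm]
  exact h2

lemma dropRow_rank (μ : Measure Y) [IsProbabilityMeasure μ]
    {M : Y → Matrix (Fin (m + 1)) (Fin ℓ) K} (hM : Measurable M)
    (hMfull : ∀ᵐ ω ∂μ, (M ω).rank = ℓ)
    (hMrot : RotationInvariant μ M) (hℓ : ℓ ≤ m) : ∀ᵐ ω ∂μ, (dropRow (M ω)).rank = ℓ := by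
  let B : Set (Matrix (Fin (m + 1)) (Fin ℓ) K) := {A | ((dropRow A)ᴴ * dropRow A).det = 0}
  have hB : MeasurableSet B := by
    have h1 : EM (fun A : Matrix (Fin (m + 1)) (Fin ℓ) K => dropRow A) :=
      EM.of_measurable dropRow_meas
    exact (h1.conjTranspose.mul h1).det (measurableSet_singleton 0)
  let v : ℕ → Fin (m + 1) → K := fun t i => (t : K) ^ (i : ℕ)
  have hv : ∀ t, v t ≠ 0 := by
    intro t h
    have := congrFun h 0
    simp [v] at this
  choose U hU k hk hUv using fun t => exists_unitary (v t) (hv t)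
  have hUM : ∀ t, Measurable fun ω => U t * M ω := fun t =>
    ((EM.const (U t)).mul (EM.of_measurable hM)).measurable
  let E : ℕ → Set Y := fun t => (fun ω => U t * M ω) ⁻¹' B
  have hE : ∀ t, MeasurableSet (E t) := fun t => hUM t hB
  have hp : ∀ t, μ (E t) = μ (M ⁻¹' B) := by
    intro t
    rw [← Measure.map_apply (hUM t) hB, hMrot (U t) (hU t), Measure.map_apply hM hB]
  have key : ∀ T : ℕ, (T : ℝ≥0∞) * μ (M ⁻¹' B) ≤ m := by
    intro T
    calc (T : ℝ≥0∞) * μ (M ⁻¹' B) = ∑ t ∈ Finset.range T, μ (E t) := by simp [hp]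
      _ = ∑ t ∈ Finset.range T, ∫⁻ ω, (E t).indicator 1 ω ∂μ := by
          refine Finset.sum_congr rfl fun t _ => ?_
          rw [lintegral_indicator_one (hE t)]
      _ = ∫⁻ ω, ∑ t ∈ Finset.range T, (E t).indicator 1 ω ∂μ := by
          rw [lintegral_finsetSum]
          exact fun t _ => measurable_one.indicator (hE t)
      _ ≤ ∫⁻ ω, (m : ℝ≥0∞) ∂μ := by
          apply lintegral_mono_ae
          filter_upwards [hMfull] with ω hω
          obtain ⟨y, hy0, hy⟩ := exists_left_null (M ω) hℓ
          classical
          have hc := card_bad hy0 ((Finset.range T).filter fun t => ω ∈ E t) (by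
            intro t ht
            exact bad_imp hω (hU t) (hk t) (hUv t) (Finset.mem_filter.mp ht).2 hy)
          simp only [Set.indicator_apply, Pi.one_apply]
          rw [Finset.sum_boole]
          exact_mod_cast hc
      _ = m := by simp
  have h0 : μ (M ⁻¹' B) = 0 := by
    by_contra hne
    have hfin : μ (M ⁻¹' B) ≠ ∞ := measure_ne_top _ _
    obtain ⟨T, hT⟩ := ENNReal.exists_nat_mul_gt hne (ENNReal.natCast_ne_top m)
    exact absurd (key T) (not_le.mpr hT)
  have h1 : ∀ᵐ ω ∂μ, ω ∉ M ⁻¹' B := measure_eq_zero_iff_ae_notMem.mp h0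
  filter_upwards [h1] with ω hω
  have hdet : ((dropRow (M ω))ᴴ * dropRow (M ω)).det ≠ 0 := hω
  rw [← Matrix.rank_conjTranspose_mul_self, Matrix.rank_of_isUnit _
    ((Matrix.isUnit_iff_isUnit_det _).mpr (isUnit_iff_ne_zero.mpr hdet)), Fintype.card_fin]

end DropMeas

section Step

variable {K : Type*} [RCLike K] {m ℓ : ℕ}

lemma twoEig_cc {q r : ℕ} (a b : ℝ) (i : Fin m) :
    (if ((i.castSucc : Fin (m + 1)) : ℕ) < q then (a : K) else
      if ((i.castSucc : Fin (m + 1)) : ℕ) < r then (b : K) else 0) =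
    if (i : ℕ) < q then (a : K) else if (i : ℕ) < r then (b : K) else 0 := rfl

lemma gram_drop {q r : ℕ} (hqm : q ≤ m) (hrm : r ≤ m) (a b : ℝ)
    (A : Matrix (Fin (m + 1)) (Fin ℓ) K) :
    Aᴴ * twoEigMatrix K (m + 1) q r a b * A =
      (dropRow A)ᴴ * twoEigMatrix K m q r a b * dropRow A := by
  ext i j
  unfold twoEigMatrix
  rw [Matrix.mul_apply, Fin.sum_univ_castSucc]
  simp only [Matrix.mul_diagonal, twoEig_cc, Fin.val_last, not_lt.mpr hqm, not_lt.mpr hrm,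
    if_false, mul_zero, zero_mul, add_zero]
  rw [Matrix.mul_apply]
  simp only [Matrix.mul_diagonal]
  rfl

lemma trace_drop {q r : ℕ} (hqm : q ≤ m) (hrm : r ≤ m) (a b : ℝ)
    (A : Matrix (Fin (m + 1)) (Fin ℓ) K) (P : Matrix (Fin ℓ) (Fin ℓ) K) :
    Matrix.trace (twoEigMatrix K (m + 1) q r a b - twoEigMatrix K (m + 1) q r a b * A *
        (P * (Aᴴ * twoEigMatrix K (m + 1) q r a b))) =
      Matrix.trace (twoEigMatrix K m q r a b - twoEigMatrix K m q r a b * dropRow A *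
        (P * ((dropRow A)ᴴ * twoEigMatrix K m q r a b))) := by
  unfold twoEigMatrix Matrix.trace
  rw [Fin.sum_univ_castSucc]
  simp only [Matrix.diag_apply, Matrix.sub_apply, Matrix.diagonal_apply_eq, twoEig_cc,
    Fin.val_last, not_lt.mpr hqm, not_lt.mpr hrm, if_false, Matrix.mul_assoc,
    Matrix.diagonal_mul, zero_mul, sub_zero, add_zero]
  refine Finset.sum_congr rfl fun i _ => ?_
  congr 2
  simp only [← Matrix.mul_assoc, Matrix.mul_diagonal, twoEig_cc]
  rfl

end Step
/-- **Nyström approximation of a matrix with two eigenvalues** (Lemma 6.2): for a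
full-rank rotation-invariant random embedding `Ω`, `b > 0`, and
`q + α_K < ℓ ≤ r ≤ n`, `lim_{a→∞} E tr(H_{a,b} − H_{a,b}⟨Ω⟩)
= b (r − ℓ) (1 + q/(ℓ − q − α_K))`. -/
theorem nystrom_two_eigenvalues
    {K : Type*} [RCLike K] [MeasurableSpace K] [BorelSpace K]
    {Y : Type*} [MeasurableSpace Y] (μ : Measure Y) [IsProbabilityMeasure μ]
    (pinv : (m n : ℕ) → Matrix (Fin m) (Fin n) K → Matrix (Fin n) (Fin m) K)
    (hpinv : ∀ (m n : ℕ) (A : Matrix (Fin m) (Fin n) K), IsMoorePenrose A (pinv m n A))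
    (n ℓ q r : ℕ) (hℓn : ℓ ≤ n)
    (M : Y → Matrix (Fin n) (Fin ℓ) K)
    (hMmeas : Measurable M)
    (hMfull : ∀ᵐ ω ∂μ, (M ω).rank = ℓ)
    (hMrot : RotationInvariant μ M)
    (b : ℝ) (hb : 0 < b)
    (hq : (q : ℝ) + alphaK K < (ℓ : ℝ)) (hℓr : ℓ ≤ r) (hrn : r ≤ n) :
    Filter.Tendsto
      (fun a : ℝ => ∫ ω, RCLike.re (Matrix.trace
        (twoEigMatrix K n q r a b -
          twoEigMatrix K n q r a b * M ω *
            (pinv ℓ ℓ ((M ω)ᴴ * twoEigMatrix K n q r a b * M ω) *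
              ((M ω)ᴴ * twoEigMatrix K n q r a b)))) ∂μ)
      Filter.atTop
      (nhds (b * ((r : ℝ) - (ℓ : ℝ)) *
        (1 + (q : ℝ) / ((ℓ : ℝ) - (q : ℝ) - alphaK K)))) := by
  have hqr : q ≤ r := by
    have h1 : (q : ℝ) < ℓ := by linarith [alphaK_nonneg (K := K)]
    exact (Nat.cast_lt.mp h1).le.trans hℓr
  clear hℓn
  induction n, hrn using Nat.le_induction with
  | base => exact base_case μ hMmeas hMfull hMrot hqr hℓr hb hq pinv hpinv
  | succ m hrm ih =>
    have h := ih (fun ω => dropRow (M ω)) (dropRow_meas.comp hMmeas)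
      (dropRow_rank μ hMmeas hMfull hMrot (hℓr.trans hrm)) (dropRow_rot μ hMmeas hMrot)
    refine h.congr fun a => ?_
    refine integral_congr_ae (Eventually.of_forall fun ω => ?_)
    dsimp only
    rw [gram_drop (hqr.trans hrm) hrm, trace_drop (hqr.trans hrm) hrm]
end
end
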